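/- arXiv:2305.01724 — 3 statements merged into one kernel-verified Lean document; each statement's English description precedes it below -/
import Mathlib

section
/- Let X = {X^{(1)},...,X^{(r)}} be r generic m×n matrices of distinct indeterminates over a field K, let A = [X^{(1)}|...|X^{(r)}] be their horizontal concatenation (size m×nr) and B the vertical concatenation (size mr×n). Fix positive integers u ≤ min(m, nr) and v ≤ min(n, mr). Then, with respect to the lexicographic order in which x^{(s)}_{ij} > x^{(t)}_{kl} iff s < t, or (s = t and i < k), or (s = t, i = k, j < l), the union of all u-minors of A and all v-minors of B is a Gröbner basis of the double determinantal ideal they generate. -/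
open MvPolynomial

/-- Leading exponent of a multivariate polynomial w.r.t. a monomial order. -/
noncomputable def mdeg {σ : Type*} (mo : MonomialOrder σ) {K : Type*} [CommSemiring K]
    (f : MvPolynomial σ K) : σ →₀ ℕ :=
  mo.toSyn.symm (f.support.sup fun e => mo.toSyn e)

/-- `G` is a Gröbner basis (of the ideal it generates) w.r.t. `mo`. -/
def IsGroebnerBasis {σ K : Type*} [Field K] (mo : MonomialOrder σ)
    (G : Set (MvPolynomial σ K)) : Prop :=
  ∀ f ∈ Ideal.span G, f ≠ 0 → ∃ g ∈ G, g ≠ 0 ∧ mdeg mo g ≤ mdeg mo f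

/-- Index of the variable `x^{(s)}_{ij}` of `r` generic `m × n` matrices, ordered so that
`x^{(s)}_{ij} > x^{(t)}_{kl}` iff `s < t`, or (`s = t` and `i < k`), or
(`s = t`, `i = k`, `j < l`). -/
abbrev PageVar (m n r : ℕ) := Lex (Fin r × Lex (Fin m × Fin n))

instance (m n r : ℕ) : Finite (PageVar m n r) :=
  inferInstanceAs (Finite (Fin r × (Fin m × Fin n)))

/-- The lexicographic monomial order on the variables of the `r` generic matrices. -/
noncomputable def lexMO3 (m n r : ℕ) : MonomialOrder (PageVar m n r) := MonomialOrder.lex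

/-- The horizontal concatenation `A = [X^{(1)}|...|X^{(r)}]` of the generic matrices. -/
noncomputable def horizCat (m n r : ℕ) (K : Type*) [Field K] :
    Matrix (Fin m) (Lex (Fin r × Fin n)) (MvPolynomial (PageVar m n r) K) :=
  Matrix.of fun i c => X (toLex ((ofLex c).1, toLex (i, (ofLex c).2)))

/-- The vertical concatenation `B` of the generic matrices. -/
noncomputable def vertCat (m n r : ℕ) (K : Type*) [Field K] :
    Matrix (Lex (Fin r × Fin m)) (Fin n) (MvPolynomial (PageVar m n r) K) :=
  Matrix.of fun c j => X (toLex ((ofLex c).1, toLex ((ofLex c).2, j)))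

/-- Chain relation. -/
def RA {σ : Type*} (k i j : σ → ℕ) (p q : σ) : Prop :=
  i p < i q ∧ (k p < k q ∨ k p = k q ∧ j p < j q)

/-- Level function of a set with respect to a relation. -/
structure IsLevel {σ : Type*} (S : σ → Prop) (R : σ → σ → Prop) (a : σ → ℕ) : Prop where
  lt : ∀ p q, S p → S q → R p q → a p < a q
  pred : ∀ q, S q → 0 < a q → ∃ p, S p ∧ R p q ∧ a p + 1 = a q

lemma exists_level {σ : Type*} [Fintype σ] (S : σ → Prop) (k i j : σ → ℕ) :
    ∃ a, IsLevel S (RA k i j) a := by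
  classical
  have key : ∀ N : ℕ, ∃ a : σ → ℕ,
      (∀ p q, i q < N → S p → S q → RA k i j p q → a p < a q) ∧
      (∀ q, i q < N → S q → 0 < a q → ∃ p, S p ∧ RA k i j p q ∧ a p + 1 = a q) := by
    intro N
    induction N with
    | zero => exact ⟨fun _ => 0, by simp, by simp⟩
    | succ N ih =>
      obtain ⟨a, h1, h2⟩ := ih
      refine ⟨fun q => if i q < N then a q else
        (Finset.univ.filter fun p => S p ∧ RA k i j p q ∧ i p < N).sup fun p => a p + 1, ?_, ?_⟩
      · intro p q hq hp hSq hR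
        have hpN : i p < N := by have := hR.1; omega
        simp only [hpN, if_true]
        split_ifs with hqN
        · exact h1 p q hqN hp hSq hR
        · have := Finset.le_sup (f := fun p => a p + 1)
            (s := Finset.univ.filter fun p => S p ∧ RA k i j p q ∧ i p < N) (b := p)
            (by simp [hp, hR, hpN])
          omega
      · intro q hq hSq hpos
        simp only at hpos ⊢
        split_ifs at hpos ⊢ with hqN
        · obtain ⟨p, hp, hR, he⟩ := h2 q hqN hSq hpos
          have hpN : i p < N := by have := hR.1; omega
          exact ⟨p, hp, hR, by simp [hpN, he]⟩
        · have hne : (Finset.univ.filter fun p => S p ∧ RA k i j p q ∧ i p < N).Nonempty := by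
            by_contra hne
            rw [Finset.not_nonempty_iff_eq_empty] at hne
            rw [hne] at hpos
            simp at hpos
          obtain ⟨p, hp, he⟩ := Finset.exists_mem_eq_sup _ hne (fun p => a p + 1)
          simp only [Finset.mem_filter, Finset.mem_univ, true_and] at hp
          exact ⟨p, hp.1, hp.2.1, by rw [he]; simp [hp.2.2]⟩
  obtain ⟨a, h1, h2⟩ := key ((Finset.univ.sup i) + 1)
  have hi : ∀ q, i q < (Finset.univ.sup i) + 1 := fun q =>
    Nat.lt_succ_of_le (Finset.le_sup (Finset.mem_univ q))
  exact ⟨a, fun p q => h1 p q (hi q), fun q => h2 q (hi q)⟩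

lemma exists_chain {σ : Type*} {S : σ → Prop} {R : σ → σ → Prop} {a : σ → ℕ}
    (h : IsLevel S R a) : ∀ (n : ℕ) (q : σ), S q → a q = n →
    ∃ f : ℕ → σ, f n = q ∧ (∀ l ≤ n, S (f l)) ∧ ∀ l < n, R (f l) (f (l + 1)) := by
  intro n
  induction n with
  | zero => exact fun q hq _ => ⟨fun _ => q, rfl, fun _ _ => hq, by simp⟩
  | succ n ih =>
    intro q hq he
    obtain ⟨p, hp, hR, hpe⟩ := h.pred q hq (by omega)
    obtain ⟨f, h1, h2, h3⟩ := ih p hp (by omega)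
    refine ⟨fun l => if l ≤ n then f l else q, by simp, ?_, ?_⟩
    · intro l _
      simp only
      split_ifs with hl
      · exact h2 l hl
      · exact hq
    · intro l hl
      have hl' : l ≤ n := by omega
      simp only [hl', if_true]
      split_ifs with h4
      · exact h3 l (by omega)
      · have : l = n := by omega
        subst this
        rwa [h1]

section Core

variable {σ : Type*} {S : σ → Prop} {k i j a b : σ → ℕ}

/-- The no-bad-pair claim. -/
lemma no_bad (ha : IsLevel S (RA k i j) a) (hb : IsLevel S (RA k j i) b) :
    ∀ (n : ℕ) (p q : σ), a p = n → S p → S q → k p = k q → i p ≤ i q → j q ≤ j p →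
      a q ≤ a p → b q ≤ b p := by
  intro n
  induction n with
  | zero =>
    intro p q hn hp hq hk hi hj hle
    by_contra hlt
    obtain ⟨q1, hq1, ⟨hR1, hR2⟩, he1⟩ := hb.pred q hq (by omega)
    have h1 : ¬ RA k j i q1 p := fun h => by have := hb.lt _ _ hq1 hp h; omega
    unfold RA at h1
    have := ha.lt q1 q hq1 hq ⟨by omega, by omega⟩
    omega
  | succ n ih =>
    intro p q hn hp hq hk hi hj hle
    by_contra hlt
    obtain ⟨q1, hq1, ⟨hR1, hR2⟩, he1⟩ := hb.pred q hq (by omega)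
    have h1 : ¬ RA k j i q1 p := fun h => by have := hb.lt _ _ hq1 hp h; omega
    unfold RA at h1
    have h2 := ha.lt q1 q hq1 hq ⟨by omega, by omega⟩
    obtain ⟨p1, hp1, ⟨hR3, hR4⟩, he2⟩ := ha.pred p hp (by omega)
    have h3 : ¬ RA k i j p1 q1 := fun h => by have := ha.lt _ _ hp1 hq1 h; omega
    unfold RA at h3
    have h4 := hb.lt p1 p hp1 hp ⟨by omega, by omega⟩
    have := ih p1 q1 (by omega) hp1 hq1 (by omega) (by omega) (by omega) (by omega)
    omega

lemma level_mono (ha : IsLevel S (RA k i j) a) (p q : σ) (hp : S p) (hq : S q)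
    (hk : k p = k q) (hi : i p ≤ i q) (hj : j p ≤ j q) : a p ≤ a q := by
  by_contra hlt
  obtain ⟨p1, hp1, ⟨h1, h2⟩, he⟩ := ha.pred p hp (by omega)
  have := ha.lt p1 q hp1 hq ⟨by omega, by omega⟩
  omega

end Core

section Sums
open Classical

/-- Sum over a predicate. -/
noncomputable def PS {X : Type*} [Fintype X] (e : X → ℕ) (P : X → Prop) : ℕ :=
  ∑ x, if P x then e x else 0

variable {X : Type*} [Fintype X]

lemma PS_le (e : X → ℕ) (P Q R : X → Prop) (h : ∀ x, 0 < e x → P x → Q x ∨ R x) :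
    PS e P ≤ PS e Q + PS e R := by
  unfold PS
  rw [← Finset.sum_add_distrib]
  refine Finset.sum_le_sum fun x _ => ?_
  have := h x
  by_cases h1 : P x <;> by_cases h2 : Q x <;> by_cases h3 : R x <;> simp_all

lemma PS_ge (e : X → ℕ) (P Q R : X → Prop) (h : ∀ x, 0 < e x → Q x ∨ R x → P x)
    (hd : ∀ x, Q x → ¬ R x) : PS e Q + PS e R ≤ PS e P := by
  unfold PS
  rw [← Finset.sum_add_distrib]
  refine Finset.sum_le_sum fun x _ => ?_
  have := h x
  have := hd x
  by_cases h1 : P x <;> by_cases h2 : Q x <;> by_cases h3 : R x <;>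
    simp only [h1, h2, h3, if_true, if_false, not_true_eq_false, imp_false, or_true,
      or_false, or_self, forall_true_left] at * <;> omega

lemma PS_pos (e : X → ℕ) (P : X → Prop) (h : 0 < PS e P) : ∃ x, P x ∧ 0 < e x := by
  unfold PS at h
  by_contra hne
  push Not at hne
  have : ∑ x, (if P x then e x else 0) = 0 := by
    refine Finset.sum_eq_zero fun x _ => ?_
    split_ifs with hx
    · have := hne x hx; omega
    · rfl
  omega

lemma PS_pos' (e : X → ℕ) (P : X → Prop) (x : X) (hx : P x) (h : 0 < e x) : 0 < PS e P := by
  unfold PS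
  refine Finset.sum_pos' (fun _ _ => Nat.zero_le _) ⟨x, Finset.mem_univ _, ?_⟩
  simp [hx, h]

lemma PS_congr (e e' : X → ℕ) (P : X → Prop) (h : ∀ x, P x → e x = e' x) : PS e P = PS e' P := by
  unfold PS
  refine Finset.sum_congr rfl fun x _ => ?_
  split_ifs with hx
  · exact h x hx
  · rfl

lemma PS_restrict (e e' : X → ℕ) (P L : X → Prop) (h : ∀ x, ¬ L x → e x = e' x)
    (hP : PS e P = PS e' P) : PS e (fun x => L x ∧ P x) = PS e' (fun x => L x ∧ P x) := by
  have h1 : ∀ f : X → ℕ, PS f P = PS f (fun x => L x ∧ P x) + PS f (fun x => ¬ L x ∧ P x) := by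
    intro f
    apply le_antisymm
    · apply PS_le; tauto
    · apply PS_ge <;> tauto
  have h2 := PS_congr e e' (fun x => ¬ L x ∧ P x) (fun x hx => h x hx.1)
  have := h1 e
  have := h1 e'
  omega

end Sums

section Main

variable {σ : Type*} [LinearOrder σ] [Fintype σ] {S : σ → Prop} {k i j a b : σ → ℕ}

lemma core_step {u v : ℕ}
    (hlt : ∀ p q : σ, p < q ↔ k p < k q ∨ k p = k q ∧ (i p < i q ∨ i p = i q ∧ j p < j q))
    (ha : IsLevel S (RA k i j) a) (hb : IsLevel S (RA k j i) b)
    (e e0 : σ × (Fin u × Fin v) → ℕ)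
    (h0 : ∀ x, 0 < e0 x → S x.1 ∧ (x.2.1 : ℕ) = a x.1 ∧ (x.2.2 : ℕ) = b x.1)
    (hY : ∀ P : ℕ → ℕ → Prop, PS e (fun x => P (i x.1) x.2.1) = PS e0 (fun x => P (i x.1) x.2.1))
    (hT : ∀ P : ℕ → ℕ → ℕ → Prop, PS e (fun x => P (k x.1) x.2.1 x.2.2) =
      PS e0 (fun x => P (k x.1) x.2.1 x.2.2))
    (hZ : ∀ P : ℕ → ℕ → Prop, PS e (fun x => P (j x.1) x.2.2) = PS e0 (fun x => P (j x.1) x.2.2))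
    (p : σ) (hp : ∀ x, x.1 < p → e x = e0 x) (c : Fin u × Fin v) :
    e0 (p, c) ≤ e (p, c) := by
  rcases Nat.eq_zero_or_pos (e0 (p, c)) with hz | hpos
  · omega
  obtain ⟨hSp, hca, hcb⟩ := h0 _ hpos
  simp only at hSp hca hcb
  set L : σ × (Fin u × Fin v) → Prop := fun x => p ≤ x.1 with hL
  have hLL : ∀ x, ¬ L x → e x = e0 x := fun x hx => hp x (not_le.1 hx)
  have hL' : ∀ x, L x ↔ k p < k x.1 ∨ k p = k x.1 ∧ (i p < i x.1 ∨ i p = i x.1 ∧ j p ≤ j x.1) := by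
    intro x
    simp only [hL]
    rw [← not_lt, hlt]
    omega
  have mY := fun P => PS_restrict e e0 _ L hLL (hY P)
  have mT := fun P => PS_restrict e e0 _ L hLL (hT P)
  have mZ := fun P => PS_restrict e e0 _ L hLL (hZ P)
  have hA : ∀ x, 0 < e0 x → (x.2.1 : ℕ) = c.1 → ¬ RA k i j p x.1 := by
    intro x hx hxc hR
    obtain ⟨h1, h2, h3⟩ := h0 x hx
    have := ha.lt _ _ hSp h1 hR
    omega
  have hB : ∀ x, 0 < e0 x → (x.2.2 : ℕ) = c.2 → ¬ RA k j i p x.1 := by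
    intro x hx hxc hR
    obtain ⟨h1, h2, h3⟩ := h0 x hx
    have := hb.lt _ _ hSp h1 hR
    omega
  -- step 1
  have s1a := PS_le e (fun x => L x ∧ (k x.1 = k p ∧ (x.2.1 : ℕ) = c.1))
    (fun x => L x ∧ (k x.1 = k p ∧ i x.1 = i p ∧ (x.2.1 : ℕ) = c.1))
    (fun x => L x ∧ (i p < i x.1 ∧ (x.2.1 : ℕ) = c.1)) (by
      intro x _ ⟨h1, h2⟩
      have := (hL' x).1 h1
      simp only [h1, true_and]
      omega)
  have s1b := PS_ge e0 (fun x => L x ∧ (k x.1 = k p ∧ (x.2.1 : ℕ) = c.1))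
    (fun x => L x ∧ (k x.1 = k p ∧ i x.1 = i p ∧ (x.2.1 : ℕ) = c.1))
    (fun x => L x ∧ (i p < i x.1 ∧ (x.2.1 : ℕ) = c.1)) (by
      rintro x hx (⟨h1, h2⟩ | ⟨h1, h2⟩)
      · exact ⟨h1, h2.1, h2.2.2⟩
      · have h3 := (hL' x).1 h1
        have h4 := hA x hx h2.2
        unfold RA at h4
        refine ⟨h1, ?_, h2.2⟩
        omega) (by intro x h1 h2; omega)
  have s1c := mT (fun k' a' _ => k' = k p ∧ a' = c.1)
  have s1d := mY (fun i' a' => i p < i' ∧ a' = c.1)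
  -- step 2
  have s2 : ∀ x, 0 < e x → L x → k x.1 = k p → i x.1 = i p → (x.2.1 : ℕ) = c.1 →
      (c.2 : ℕ) ≤ x.2.2 := by
    intro x hx h1 h2 h3 h4
    by_contra hbb
    have h5 := (hL' x).1 h1
    have t1 := mT (fun k' a' b' => k' = k p ∧ a' = c.1 ∧ b' = x.2.2)
    have t2 := mZ (fun j' b' => j' = j x.1 ∧ b' = x.2.2)
    have t3 := PS_pos' e (fun y => L y ∧ (k y.1 = k p ∧ (y.2.1 : ℕ) = c.1 ∧
      (y.2.2 : ℕ) = x.2.2)) x ⟨h1, h2, h4, rfl⟩ hx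
    have t4 := PS_pos' e (fun y => L y ∧ (j y.1 = j x.1 ∧ (y.2.2 : ℕ) = x.2.2)) x
      ⟨h1, rfl, rfl⟩ hx
    rw [t1] at t3
    rw [t2] at t4
    obtain ⟨y, ⟨hy1, hy2, hy3, hy4⟩, hy⟩ := PS_pos _ _ t3
    obtain ⟨z, ⟨hz1, hz2, hz3⟩, hz⟩ := PS_pos _ _ t4
    obtain ⟨hy5, hy6, hy7⟩ := h0 y hy
    obtain ⟨hz5, hz6, hz7⟩ := h0 z hz
    have hy8 := (hL' y).1 hy1
    have hz8 := (hL' z).1 hz1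
    have hy9 := hA y hy hy3
    unfold RA at hy9
    have hy10 : ¬ (j p ≤ j y.1) := fun hj => by
      have := level_mono hb p y.1 hSp hy5 (by omega) hj (by omega)
      omega
    by_cases hk : k z.1 = k p
    · have := level_mono hb p z.1 hSp hz5 (by omega) (by omega) (by omega)
      omega
    · have := hb.lt y.1 z.1 hy5 hz5 ⟨by omega, by omega⟩
      omega
  -- step 3
  have s3a := PS_le e (fun x => L x ∧ (k x.1 = k p ∧ i x.1 = i p ∧ (x.2.1 : ℕ) = c.1))
    (fun x => L x ∧ (k x.1 = k p ∧ i x.1 = i p ∧ (x.2.1 : ℕ) = c.1 ∧ (x.2.2 : ℕ) = c.2))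
    (fun x => L x ∧ (k x.1 = k p ∧ (x.2.1 : ℕ) = c.1 ∧ (c.2 : ℕ) < x.2.2)) (by
      intro x hx ⟨h1, h2, h3, h4⟩
      have := s2 x hx h1 h2 h3 h4
      simp only [h1, true_and]
      omega)
  have s3b := PS_ge e0 (fun x => L x ∧ (k x.1 = k p ∧ i x.1 = i p ∧ (x.2.1 : ℕ) = c.1))
    (fun x => L x ∧ (k x.1 = k p ∧ i x.1 = i p ∧ (x.2.1 : ℕ) = c.1 ∧ (x.2.2 : ℕ) = c.2))
    (fun x => L x ∧ (k x.1 = k p ∧ (x.2.1 : ℕ) = c.1 ∧ (c.2 : ℕ) < x.2.2)) (by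
      rintro x hx (⟨h1, h2⟩ | ⟨h1, h2, h3, h4⟩)
      · exact ⟨h1, h2.1, h2.2.1, h2.2.2.1⟩
      · refine ⟨h1, h2, ?_, h3⟩
        obtain ⟨g1, g2, g3⟩ := h0 x hx
        have h5 := (hL' x).1 h1
        have h6 := hA x hx h3
        unfold RA at h6
        by_contra hne
        have := no_bad ha hb _ p x.1 rfl hSp g1 h2.symm (by omega) (by omega) (by omega)
        omega) (by intro x h1 h2; omega)
  have s3c := mT (fun k' a' b' => k' = k p ∧ a' = c.1 ∧ (c.2 : ℕ) < b')
  -- step 4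
  have s4a := PS_le e
    (fun x => L x ∧ (k x.1 = k p ∧ i x.1 = i p ∧ (x.2.1 : ℕ) = c.1 ∧ (x.2.2 : ℕ) = c.2))
    (fun x => x = (p, c))
    (fun x => L x ∧ (j p < j x.1 ∧ (x.2.2 : ℕ) = c.2)) (by
      intro x hx ⟨h1, h2, h3, h4, h5⟩
      have h6 := (hL' x).1 h1
      by_cases hj : j p < j x.1
      · exact Or.inr ⟨h1, hj, h5⟩
      · left
        refine Prod.ext ?_ (Prod.ext (Fin.ext h4) (Fin.ext h5))
        refine le_antisymm (not_lt.1 fun h => ?_) h1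
        rw [hlt] at h
        simp only at h
        omega)
  have s4b := PS_ge e0
    (fun x => L x ∧ (k x.1 = k p ∧ i x.1 = i p ∧ (x.2.1 : ℕ) = c.1 ∧ (x.2.2 : ℕ) = c.2))
    (fun x => x = (p, c))
    (fun x => L x ∧ (j p < j x.1 ∧ (x.2.2 : ℕ) = c.2)) (by
      rintro x hx (rfl | ⟨h1, h2, h3⟩)
      · exact ⟨le_refl p, rfl, rfl, rfl, rfl⟩
      · obtain ⟨g1, g2, g3⟩ := h0 x hx
        have h5 := (hL' x).1 h1
        have h6 := hB x hx h3
        unfold RA at h6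
        have g4 := level_mono ha p x.1 hSp g1 (by omega) (by omega) (by omega)
        have g5 := no_bad hb ha _ p x.1 rfl hSp g1 (by omega) (by omega) (by omega) (by omega)
        refine ⟨h1, ?_, ?_, ?_, h3⟩ <;> omega) (by
      rintro x rfl h2
      have := h2.2.1
      simp at this)
  have s4c := mZ (fun j' b' => j p < j' ∧ b' = c.2)
  have s5 : ∀ f : σ × (Fin u × Fin v) → ℕ, PS f (fun x => x = (p, c)) = f (p, c) := by
    intro f
    unfold PS
    rw [Finset.sum_eq_single (p, c)]
    · simp
    · intro x _ hx
      simp [hx]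
    · simp
  rw [s5] at s4a s4b
  omega

/-- Minimality: any other colouring with the same margins gives a lex-larger monomial. -/
lemma core {u v : ℕ}
    (hlt : ∀ p q : σ, p < q ↔ k p < k q ∨ k p = k q ∧ (i p < i q ∨ i p = i q ∧ j p < j q))
    (ha : IsLevel S (RA k i j) a) (hb : IsLevel S (RA k j i) b)
    (e e0 : σ → Fin u × Fin v → ℕ)
    (h0 : ∀ p c, 0 < e0 p c → S p ∧ (c.1 : ℕ) = a p ∧ (c.2 : ℕ) = b p)
    (hY : ∀ P : ℕ → ℕ → Prop, PS (fun x : σ × (Fin u × Fin v) => e x.1 x.2)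
        (fun x => P (i x.1) x.2.1) =
      PS (fun x : σ × (Fin u × Fin v) => e0 x.1 x.2) (fun x => P (i x.1) x.2.1))
    (hT : ∀ P : ℕ → ℕ → ℕ → Prop, PS (fun x : σ × (Fin u × Fin v) => e x.1 x.2)
        (fun x => P (k x.1) x.2.1 x.2.2) =
      PS (fun x : σ × (Fin u × Fin v) => e0 x.1 x.2) (fun x => P (k x.1) x.2.1 x.2.2))
    (hZ : ∀ P : ℕ → ℕ → Prop, PS (fun x : σ × (Fin u × Fin v) => e x.1 x.2)
        (fun x => P (j x.1) x.2.2) =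
      PS (fun x : σ × (Fin u × Fin v) => e0 x.1 x.2) (fun x => P (j x.1) x.2.2))
    (hne : e ≠ e0) :
    ∃ p, (∀ q < p, ∑ c, e0 q c = ∑ c, e q c) ∧ ∑ c, e0 p c < ∑ c, e p c := by
  obtain ⟨p0, hp0⟩ : ∃ p, e p ≠ e0 p := by
    by_contra h
    push Not at h
    exact hne (funext h)
  have hwf : WellFounded ((· < ·) : σ → σ → Prop) := Finite.to_wellFoundedLT.wf
  obtain ⟨p, hp, hmin⟩ := hwf.has_min {p | e p ≠ e0 p} ⟨p0, hp0⟩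
  have hbelow : ∀ q < p, e q = e0 q := by
    intro q hq
    by_contra h
    exact hmin q h hq
  refine ⟨p, fun q hq => by rw [hbelow q hq], ?_⟩
  have hle : ∀ c, e0 p c ≤ e p c := fun c =>
    core_step hlt ha hb (fun x => e x.1 x.2) (fun x => e0 x.1 x.2) (fun x => h0 x.1 x.2)
      hY hT hZ p (fun x hx => by simp only [hbelow _ hx]) c
  obtain ⟨c, hc⟩ : ∃ c, e p c ≠ e0 p c := by
    by_contra h
    push Not at h
    exact hp (funext h)
  exact Finset.sum_lt_sum (fun c _ => hle c) ⟨c, Finset.mem_univ _, lt_of_le_of_ne (hle c) (Ne.symm hc)⟩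

end Main

section Algebra
open MvPolynomial

lemma det_mul_eq_zero {R : Type*} [CommRing R] [IsDomain R] {u u' : ℕ} (h : u' < u)
    (Y : Matrix (Fin u) (Fin u') R) (Z : Matrix (Fin u') (Fin u) R) : (Y * Z).det = 0 := by
  by_contra hne
  have h1 := Matrix.rank_of_det_ne_zero hne
  have h2 := Matrix.rank_mul_le_left Y Z
  have h3 := Matrix.rank_le_card_width Y
  simp at h1 h3
  omega

lemma coeff_expand {σ τ C K : Type*} [Fintype σ] [DecidableEq σ] [Fintype C] [DecidableEq C]
    [DecidableEq τ] [Field K]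
    (w : σ → C → τ →₀ ℕ) (m : σ → ℕ) (N : τ →₀ ℕ) :
    coeff N (∏ p, (∑ c, monomial (w p c) (1 : K)) ^ (m p)) =
      ∑ e ∈ Fintype.piFinset fun p => Finset.piAntidiag (Finset.univ : Finset C) (m p),
        if (∑ p, ∑ c, e p c • w p c) = N then ((∏ p, Nat.multinomial Finset.univ (e p) : ℕ) : K)
        else 0 := by
  simp_rw [Finset.sum_pow_eq_sum_piAntidiag]
  rw [Finset.prod_univ_sum, coeff_sum]
  refine Finset.sum_congr rfl fun e _ => ?_
  rw [Finset.prod_mul_distrib]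
  simp_rw [monomial_pow, one_pow]
  have h1 : ∀ p, ∏ c, monomial (e p c • w p c) (1 : K) = monomial (∑ c, e p c • w p c) 1 := by
    intro p
    rw [monomial_sum_one]
  simp_rw [h1]
  rw [← monomial_sum_one]
  rw [← Nat.cast_prod]
  rw [← map_natCast (MvPolynomial.C : K →+* MvPolynomial τ K), coeff_C_mul, coeff_monomial]
  split_ifs <;> simp

lemma phi_ne_zero {σ τ C K : Type*} [Fintype σ] [LinearOrder σ] [Fintype C] [DecidableEq C]
    [DecidableEq τ] [Field K] (w : σ → C → τ →₀ ℕ) (f : MvPolynomial σ K) (hf : f ≠ 0)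
    (e0 : σ → C → ℕ)
    (h1 : ∀ p, ∑ c, e0 p c = (MonomialOrder.lex.degree f) p)
    (h2 : ∀ p, Nat.multinomial Finset.univ (e0 p) = 1)
    (h3 : ∀ e : σ → C → ℕ, ∑ p, ∑ c, e p c • w p c = ∑ p, ∑ c, e0 p c • w p c → e ≠ e0 →
      ∃ p, (∀ q < p, ∑ c, e0 q c = ∑ c, e q c) ∧ ∑ c, e0 p c < ∑ c, e p c) :
    aeval (fun p => ∑ c, monomial (w p c) (1 : K)) f ≠ 0 := by
  set M := MonomialOrder.lex.degree f with hM
  set N := ∑ p, ∑ c, e0 p c • w p c with hN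
  intro h0
  have h4 : coeff N (aeval (fun p => ∑ c, monomial (w p c) (1 : K)) f) = 0 := by rw [h0]; simp
  rw [aeval_def, eval₂_eq', coeff_sum] at h4
  simp only [algebraMap_eq, coeff_C_mul, coeff_expand] at h4
  have hMs : M ∈ f.support := MonomialOrder.lex.degree_mem_support hf
  rw [Finset.sum_eq_single M] at h4
  · rw [Finset.sum_eq_single e0] at h4
    · simp only [hN, if_true, h2, Finset.prod_const_one, Nat.cast_one, mul_one] at h4
      exact (mem_support_iff.1 hMs) h4
    · intro e he hne
      rw [if_neg]
      intro hE
      obtain ⟨p, _, hp⟩ := h3 e hE hne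
      have := Fintype.mem_piFinset.1 he p
      rw [Finset.mem_piAntidiag] at this
      rw [this.1, h1] at hp
      omega
    · intro hn
      exfalso
      apply hn
      rw [Fintype.mem_piFinset]
      intro p
      rw [Finset.mem_piAntidiag]
      exact ⟨h1 p, by simp⟩
  · intro m hm hne
    rw [Finset.sum_eq_zero, mul_zero]
    intro e he
    rw [if_neg]
    intro hE
    have hem : ∀ p, ∑ c, e p c = m p := fun p => by
      have := Fintype.mem_piFinset.1 he p
      rw [Finset.mem_piAntidiag] at this
      exact this.1
    have hne' : e ≠ e0 := by
      rintro rfl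
      apply hne
      ext p
      rw [← h1, hem]
    obtain ⟨p, hp1, hp2⟩ := h3 e hE hne'
    have hle := MonomialOrder.lex.le_degree hm
    have hlt : MonomialOrder.lex.toSyn M < MonomialOrder.lex.toSyn m := by
      rw [MonomialOrder.lex_lt_iff, Finsupp.Lex.lt_iff]
      refine ⟨p, fun q hq => ?_, ?_⟩
      · have := hp1 q hq
        rw [h1, hem] at this
        exact this
      · rw [h1, hem] at hp2
        exact hp2
    exact absurd hle (not_le.2 hlt)
  · intro h; exact absurd hMs h

lemma minor_degree {σ K : Type*} [Fintype σ] [LinearOrder σ] [Field K] {u : ℕ}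
    (x : Fin u → Fin u → σ)
    (hx : ∀ i i' j j', i ≤ i' → j ≤ j' → (i ≠ i' ∨ j ≠ j') → x i j < x i' j')
    (M : σ →₀ ℕ) (hM : ∀ l, M (x l l) ≠ 0) (g : MvPolynomial σ K)
    (hg : g = (Matrix.of fun i j => (X (x i j) : MvPolynomial σ K)).det) :
    g ≠ 0 ∧ MonomialOrder.lex.degree g ≤ M := by
  classical
  set E : Equiv.Perm (Fin u) → σ →₀ ℕ := fun s => ∑ l, Finsupp.single (x (s l) l) 1 with hE
  have hg2 : g = ∑ s : Equiv.Perm (Fin u), monomial (E s) (((Equiv.Perm.sign s : ℤ) : K)) := by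
    rw [hg, Matrix.det_apply']
    refine Finset.sum_congr rfl fun s _ => ?_
    simp only [Matrix.of_apply, hE]
    have : ∏ l, (X (x (s l) l) : MvPolynomial σ K) = monomial (∑ l, Finsupp.single (x (s l) l) 1) 1 := by
      rw [monomial_sum_one]
      rfl
    rw [this, ← map_intCast (C : K →+* MvPolynomial σ K), C_mul_monomial, mul_one]
  have hEs : ∀ s q, E s q = ∑ l, if x (s l) l = q then 1 else 0 := by
    intro s q
    simp only [hE, Finsupp.finsetSum_apply, Finsupp.single_apply]
  have hlt : ∀ s : Equiv.Perm (Fin u), s ≠ 1 →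
      MonomialOrder.lex.toSyn (E s) < MonomialOrder.lex.toSyn (E 1) := by
    intro s hs
    obtain ⟨i0, hi0⟩ : ∃ i, s i ≠ i := by
      by_contra h
      push Not at h
      exact hs (Equiv.ext h)
    have hwf : WellFounded ((· < ·) : Fin u → Fin u → Prop) := Finite.to_wellFoundedLT.wf
    obtain ⟨i, hi, hmin⟩ := hwf.has_min {i | s i ≠ i} ⟨i0, hi0⟩
    have hfix : ∀ l < i, s l = l := by
      intro l hl
      by_contra h
      exact hmin l h hl
    have hge : ∀ l, i ≤ l → i ≤ s l := by
      intro l hl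
      by_contra h
      push Not at h
      have h1 := hfix _ h
      have := s.injective h1
      rw [this] at h
      exact absurd hl (not_le.2 h)
    have hgt : ∀ l, i ≤ l → x i i < x (s l) l := by
      intro l hl
      apply hx _ _ _ _ (hge l hl) hl
      by_cases h : i = l
      · subst h; left; exact fun h => hi h.symm
      · exact Or.inr h
    have hge1 : ∀ l, i ≤ l → x i i ≤ x l l := by
      intro l hl
      by_cases h : i = l
      · subst h; rfl
      · exact (hx _ _ _ _ hl hl (Or.inl h)).le
    rw [MonomialOrder.lex_lt_iff, Finsupp.Lex.lt_iff]
    refine ⟨x i i, fun q hq => ?_, ?_⟩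
    · change E s q = E 1 q
      rw [hEs, hEs]
      refine Finset.sum_congr rfl fun l _ => ?_
      by_cases hl : l < i
      · rw [hfix l hl]; rfl
      · push Not at hl
        rw [if_neg, if_neg]
        · exact (lt_of_lt_of_le hq (hge1 l hl)).ne'
        · exact (hq.trans (hgt l hl)).ne'
    · change E s _ < E 1 _
      rw [hEs, hEs]
      apply Finset.sum_lt_sum
      · intro l _
        by_cases hl : l < i
        · rw [hfix l hl]; rfl
        · push Not at hl
          rw [if_neg (hgt l hl).ne']
          exact Nat.zero_le _
      · refine ⟨i, Finset.mem_univ _, ?_⟩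
        rw [if_neg (hgt i le_rfl).ne']
        simp
  have hc : coeff (E 1) g = 1 := by
    rw [hg2, coeff_sum, Finset.sum_eq_single 1]
    · simp
    · intro s _ hs
      rw [coeff_monomial, if_neg]
      intro h
      exact absurd (hlt s hs) (by rw [h]; exact lt_irrefl _)
    · simp
  have hne : g ≠ 0 := by
    rintro rfl
    simp at hc
  refine ⟨hne, ?_⟩
  have hdeg : MonomialOrder.lex.degree g = E 1 := by
    apply MonomialOrder.lex.toSyn.injective
    apply le_antisymm
    · rw [MonomialOrder.degree_le_iff]
      intro d hd
      rw [mem_support_iff, hg2, coeff_sum] at hd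
      obtain ⟨s, _, hs⟩ := Finset.exists_ne_zero_of_sum_ne_zero hd
      rw [coeff_monomial] at hs
      have : E s = d := by
        by_contra h
        rw [if_neg h] at hs
        exact hs rfl
      rw [← this]
      by_cases h : s = 1
      · rw [h]
      · exact (hlt s h).le
    · apply MonomialOrder.le_degree
      rw [mem_support_iff, hc]
      exact one_ne_zero
  rw [hdeg]
  intro q
  rw [hEs]
  by_cases h : ∃ l, x l l = q
  · obtain ⟨l, rfl⟩ := h
    rw [Finset.sum_eq_single l]
    · simp only [Equiv.Perm.coe_one, id_eq, if_true]
      exact Nat.one_le_iff_ne_zero.2 (hM l)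
    · intro l' _ hl'
      rw [if_neg]
      simp only [Equiv.Perm.coe_one, id_eq]
      rcases lt_or_gt_of_ne hl' with h | h
      · exact (hx _ _ _ _ h.le h.le (Or.inl h.ne)).ne
      · exact (hx _ _ _ _ h.le h.le (Or.inl h.ne)).ne'
    · simp
  · push Not at h
    rw [Finset.sum_eq_zero]
    · exact Nat.zero_le _
    · intro l _
      rw [if_neg]
      exact h l

end Algebra

section Assembly
open MvPolynomial

/-- Page, row, column of a variable. -/
def pgv {m n r : ℕ} (p : PageVar m n r) : Fin r := (ofLex p).1
def rwv {m n r : ℕ} (p : PageVar m n r) : Fin m := (ofLex (ofLex p).2).1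
def clv {m n r : ℕ} (p : PageVar m n r) : Fin n := (ofLex (ofLex p).2).2

lemma pv_lt {m n r : ℕ} (p q : PageVar m n r) : p < q ↔ (pgv p : ℕ) < pgv q ∨
    (pgv p : ℕ) = pgv q ∧ ((rwv p : ℕ) < rwv q ∨ (rwv p : ℕ) = rwv q ∧ (clv p : ℕ) < clv q) := by
  rw [Prod.Lex.lt_iff, Prod.Lex.lt_iff]
  simp only [pgv, rwv, clv, Fin.lt_def, Fin.ext_iff]

/-- Parameters. -/
abbrev Tau (m n r u v : ℕ) :=
  (Fin m × Fin u) ⊕ ((Fin r × Fin u × Fin v) ⊕ (Fin n × Fin v))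

/-- The exponent vector. -/
noncomputable def wt {m n r u v : ℕ} (p : PageVar m n r) (c : Fin u × Fin v) :
    Tau m n r u v →₀ ℕ :=
  Finsupp.single (Sum.inl (rwv p, c.1)) 1 +
  (Finsupp.single (Sum.inr (Sum.inl (pgv p, c.1, c.2))) 1 +
   Finsupp.single (Sum.inr (Sum.inr (clv p, c.2))) 1)

/-- The parametrization. -/
noncomputable def phi (m n r u v : ℕ) (K : Type*) [Field K] :
    MvPolynomial (PageVar m n r) K →ₐ[K] MvPolynomial (Tau m n r u v) K :=
  aeval fun p => ∑ c, monomial (wt p c) (1 : K)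

lemma phi_X {m n r u v : ℕ} {K : Type*} [Field K] (p : PageVar m n r) :
    phi m n r u v K (X p) = ∑ a, ∑ b, (X (Sum.inl (rwv p, a)) *
      (X (Sum.inr (Sum.inl (pgv p, a, b))) * X (Sum.inr (Sum.inr (clv p, b))))) := by
  rw [phi, aeval_X, Fintype.sum_prod_type]
  refine Finset.sum_congr rfl fun a _ => Finset.sum_congr rfl fun b _ => ?_
  simp only [wt, X, monomial_mul, one_mul]

lemma phi_horiz {m n r u v : ℕ} {K : Type*} [Field K] (a : Fin (u + 1) → Fin m)
    (b : Fin (u + 1) → Lex (Fin r × Fin n)) :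
    phi m n r u v K (((horizCat m n r K).submatrix a b).det) = 0 := by
  rw [AlgHom.map_det]
  have : (phi m n r u v K).mapMatrix ((horizCat m n r K).submatrix a b) =
      (Matrix.of fun i c => X (Sum.inl (a i, c)) :
        Matrix (Fin (u + 1)) (Fin u) (MvPolynomial (Tau m n r u v) K)) *
      (Matrix.of fun c j => ∑ d, (X (Sum.inr (Sum.inl ((ofLex (b j)).1, c, d))) *
        X (Sum.inr (Sum.inr ((ofLex (b j)).2, d)))) :
        Matrix (Fin u) (Fin (u + 1)) (MvPolynomial (Tau m n r u v) K)) := by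
    ext1 i j
    simp only [AlgHom.mapMatrix_apply, Matrix.map_apply, Matrix.submatrix_apply, horizCat,
      Matrix.of_apply, phi_X, Matrix.mul_apply, Finset.mul_sum]
    rfl
  rw [this]
  exact det_mul_eq_zero (Nat.lt_succ_self u) _ _

lemma phi_vert {m n r u v : ℕ} {K : Type*} [Field K] (a : Fin (v + 1) → Lex (Fin r × Fin m))
    (b : Fin (v + 1) → Fin n) :
    phi m n r u v K (((vertCat m n r K).submatrix a b).det) = 0 := by
  rw [AlgHom.map_det]
  have : (phi m n r u v K).mapMatrix ((vertCat m n r K).submatrix a b) =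
      (Matrix.of fun i d => ∑ c, (X (Sum.inl ((ofLex (a i)).2, c)) *
        X (Sum.inr (Sum.inl ((ofLex (a i)).1, c, d)))) :
        Matrix (Fin (v + 1)) (Fin v) (MvPolynomial (Tau m n r u v) K)) *
      (Matrix.of fun d j => X (Sum.inr (Sum.inr (b j, d))) :
        Matrix (Fin v) (Fin (v + 1)) (MvPolynomial (Tau m n r u v) K)) := by
    ext1 i j
    simp only [AlgHom.mapMatrix_apply, Matrix.map_apply, Matrix.submatrix_apply, vertCat,
      Matrix.of_apply, phi_X, Matrix.mul_apply, Finset.sum_mul]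
    rw [Finset.sum_comm]
    refine Finset.sum_congr rfl fun d _ => Finset.sum_congr rfl fun c _ => ?_
    rw [mul_assoc]
    rfl
  rw [this]
  exact det_mul_eq_zero (Nat.lt_succ_self v) _ _

lemma margin {m n r u v : ℕ} (e e0 : PageVar m n r → Fin u × Fin v → ℕ)
    (h : ∑ p, ∑ c, e p c • wt p c = ∑ p, ∑ c, e0 p c • wt p c)
    (g : Tau m n r u v → ℕ) :
    ∑ x : PageVar m n r × (Fin u × Fin v), e x.1 x.2 *
      (g (Sum.inl (rwv x.1, x.2.1)) + (g (Sum.inr (Sum.inl (pgv x.1, x.2.1, x.2.2))) +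
        g (Sum.inr (Sum.inr (clv x.1, x.2.2))))) =
    ∑ x : PageVar m n r × (Fin u × Fin v), e0 x.1 x.2 *
      (g (Sum.inl (rwv x.1, x.2.1)) + (g (Sum.inr (Sum.inl (pgv x.1, x.2.1, x.2.2))) +
        g (Sum.inr (Sum.inr (clv x.1, x.2.2))))) := by
  have h2 := congrArg (Finsupp.linearCombination ℕ g) h
  simp only [map_sum, map_smul, wt, map_add, Finsupp.linearCombination_single, smul_eq_mul,
    one_mul] at h2
  rw [Fintype.sum_prod_type, Fintype.sum_prod_type]
  exact h2

lemma lead_not_free {m n r u v : ℕ} {K : Type*} [Field K] (f : MvPolynomial (PageVar m n r) K)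
    (hf : f ≠ 0) (h0 : phi m n r u v K f = 0)
    (a b : PageVar m n r → ℕ)
    (ha : IsLevel (fun p => MonomialOrder.lex.degree f p ≠ 0)
      (RA (fun p => (pgv p : ℕ)) (fun p => (rwv p : ℕ)) (fun p => (clv p : ℕ))) a)
    (hb : IsLevel (fun p => MonomialOrder.lex.degree f p ≠ 0)
      (RA (fun p => (pgv p : ℕ)) (fun p => (clv p : ℕ)) (fun p => (rwv p : ℕ))) b)
    (hau : ∀ p, MonomialOrder.lex.degree f p ≠ 0 → a p < u)
    (hbv : ∀ p, MonomialOrder.lex.degree f p ≠ 0 → b p < v) : False := by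
  classical
  set M := MonomialOrder.lex.degree f with hM
  set e0 : PageVar m n r → Fin u × Fin v → ℕ := fun p c =>
    if (c.1 : ℕ) = a p ∧ (c.2 : ℕ) = b p then M p else 0 with he0
  have hcase : ∀ p, (M p = 0 ∧ e0 p = fun _ => 0) ∨ ∃ c, e0 p = Pi.single c (M p) := by
    intro p
    by_cases hp : M p = 0
    · left
      exact ⟨hp, by ext c; simp [he0, hp]⟩
    · right
      refine ⟨(⟨a p, hau p hp⟩, ⟨b p, hbv p hp⟩), ?_⟩
      ext c
      simp only [he0, Pi.single_apply, Prod.ext_iff, Fin.ext_iff]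
  refine phi_ne_zero (wt (u := u) (v := v)) f hf e0 ?_ ?_ ?_ h0
  · intro p
    rcases hcase p with ⟨h1, h2⟩ | ⟨c, h2⟩
    · rw [h2, ← hM, h1]; simp
    · rw [h2]; simp [hM]
  · intro p
    rcases hcase p with ⟨h1, h2⟩ | ⟨c, h2⟩
    · rw [h2]; simp [Nat.multinomial]
    · rw [h2, Nat.multinomial_single]
  · intro e he hne
    have hm := margin e e0 he
    refine core pv_lt ha hb e e0 ?_ ?_ ?_ ?_ hne
    · intro p c hpc
      simp only [he0] at hpc
      split_ifs at hpc with hc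
      · exact ⟨hpc.ne', hc⟩
      · exact absurd hpc (lt_irrefl _)
    · intro P
      have := hm (Sum.elim (fun y => if P y.1 y.2 then 1 else 0) fun _ => 0)
      simpa [PS] using this
    · intro P
      have := hm (Sum.elim (fun _ => 0) (Sum.elim
        (fun y => if P y.1 y.2.1 y.2.2 then 1 else 0) fun _ => 0))
      simpa [PS] using this
    · intro P
      have := hm (Sum.elim (fun _ => 0) (Sum.elim (fun _ => 0)
        (fun y => if P y.1 y.2 then 1 else 0)))
      simpa [PS] using this

end Assembly

/-- The union of the `u`-minors of `A` and the `v`-minors of `B` is a Gröbner basis of the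
double determinantal ideal, with respect to the consistent lexicographic order. -/
theorem stmt_11 {K : Type*} [Field K] (m n r u v : ℕ) (hu1 : 1 ≤ u) (hv1 : 1 ≤ v)
    (hum : u ≤ m) (hunr : u ≤ n * r) (hvn : v ≤ n) (hvmr : v ≤ m * r) :
    IsGroebnerBasis (lexMO3 m n r)
      ({f : MvPolynomial (PageVar m n r) K |
          ∃ (a : Fin u → Fin m) (b : Fin u → Lex (Fin r × Fin n)),
            StrictMono a ∧ StrictMono b ∧
            f = ((horizCat m n r K).submatrix a b).det} ∪
       {f : MvPolynomial (PageVar m n r) K |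
          ∃ (a : Fin v → Lex (Fin r × Fin m)) (b : Fin v → Fin n),
            StrictMono a ∧ StrictMono b ∧
            f = ((vertCat m n r K).submatrix a b).det}) := by
  classical
  obtain ⟨u, rfl⟩ : ∃ u', u = u' + 1 := ⟨u - 1, by omega⟩
  obtain ⟨v, rfl⟩ : ∃ v', v = v' + 1 := ⟨v - 1, by omega⟩
  intro f hf hf0
  have hphi : phi m n r u v K f = 0 := by
    rw [← RingHom.mem_ker]
    refine (Ideal.span_le.2 ?_) hf
    rintro g (⟨a, b, _, _, rfl⟩ | ⟨a, b, _, _, rfl⟩)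
    · exact phi_horiz a b
    · exact phi_vert a b
  by_contra hno
  push Not at hno
  have hdeg : ∀ g : MvPolynomial (PageVar m n r) K,
    mdeg (lexMO3 m n r) g = MonomialOrder.lex.degree g := fun g => rfl
  simp only [hdeg] at hno
  set M := MonomialOrder.lex.degree f with hM
  obtain ⟨a, ha⟩ := exists_level (fun p => M p ≠ 0)
    (fun p : PageVar m n r => (pgv p : ℕ)) (fun p => (rwv p : ℕ)) (fun p => (clv p : ℕ))
  obtain ⟨b, hb⟩ := exists_level (fun p => M p ≠ 0)
    (fun p : PageVar m n r => (pgv p : ℕ)) (fun p => (clv p : ℕ)) (fun p => (rwv p : ℕ))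
  refine lead_not_free f hf0 hphi a b ha hb ?_ ?_
  · intro p hp
    by_contra hge
    push Not at hge
    obtain ⟨F, _, hF2, hF3⟩ := exists_chain ha (a p) p hp rfl
    set α : Fin (u + 1) → Fin m := fun l => rwv (F l) with hα
    set β : Fin (u + 1) → Lex (Fin r × Fin n) := fun l => toLex (pgv (F l), clv (F l)) with hβ
    have hαm : StrictMono α := by
      rw [Fin.strictMono_iff_lt_succ]
      intro l
      exact (hF3 l (by omega)).1
    have hβm : StrictMono β := by
      rw [Fin.strictMono_iff_lt_succ]
      intro l
      rw [Prod.Lex.lt_iff]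
      rcases (hF3 l (by omega)).2 with h | ⟨h, h'⟩
      · exact Or.inl h
      · exact Or.inr ⟨Fin.ext h, h'⟩
    have hmin := minor_degree (K := K)
      (fun i j => (toLex ((ofLex (β j)).1, toLex (α i, (ofLex (β j)).2)) : PageVar m n r))
      (by
        intro i i' j j' hi hj hne
        have h1 := hαm.monotone hi
        have h2 := hβm.monotone hj
        have h3 : α i < α i' ∨ β j < β j' := by
          rcases hne with h | h
          · exact Or.inl (hαm (lt_of_le_of_ne hi h))
          · exact Or.inr (hβm (lt_of_le_of_ne hj h))
        rw [Prod.Lex.lt_iff] at h3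
        rw [Prod.Lex.le_iff] at h2
        rw [pv_lt]
        simp only [Fin.lt_def, Fin.le_def, Fin.ext_iff] at h1 h2 h3
        simp only [pgv, rwv, clv, ofLex_toLex]
        omega) M (by
        intro l
        exact hF2 l (by omega)) _ rfl
    exact hno _ (Or.inl ⟨α, β, hαm, hβm, rfl⟩) hmin.1 hmin.2
  · intro p hp
    by_contra hge
    push Not at hge
    obtain ⟨F, _, hF2, hF3⟩ := exists_chain hb (b p) p hp rfl
    set α : Fin (v + 1) → Lex (Fin r × Fin m) := fun l => toLex (pgv (F l), rwv (F l)) with hα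
    set β : Fin (v + 1) → Fin n := fun l => clv (F l) with hβ
    have hβm : StrictMono β := by
      rw [Fin.strictMono_iff_lt_succ]
      intro l
      exact (hF3 l (by omega)).1
    have hαm : StrictMono α := by
      rw [Fin.strictMono_iff_lt_succ]
      intro l
      rw [Prod.Lex.lt_iff]
      rcases (hF3 l (by omega)).2 with h | ⟨h, h'⟩
      · exact Or.inl h
      · exact Or.inr ⟨Fin.ext h, h'⟩
    have hmin := minor_degree (K := K)
      (fun i j => (toLex ((ofLex (α i)).1, toLex ((ofLex (α i)).2, β j)) : PageVar m n r))
      (by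
        intro i i' j j' hi hj hne
        have h1 := hαm.monotone hi
        have h2 := hβm.monotone hj
        have h3 : α i < α i' ∨ β j < β j' := by
          rcases hne with h | h
          · exact Or.inl (hαm (lt_of_le_of_ne hi h))
          · exact Or.inr (hβm (lt_of_le_of_ne hj h))
        rw [Prod.Lex.lt_iff] at h3
        rw [Prod.Lex.le_iff] at h1
        rw [pv_lt]
        simp only [Fin.lt_def, Fin.le_def, Fin.ext_iff] at h1 h2 h3
        simp only [pgv, rwv, clv, ofLex_toLex]
        omega) M (by
        intro l
        exact hF2 l (by omega)) _ rfl
    exact hno _ (Or.inr ⟨α, β, hαm, hβm, rfl⟩) hmin.1 hmin.2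
end

section
/- With the notation of the double determinantal ideal: the initial ideal of I^{(r)}_{m,n,u,v} with respect to the consistent lexicographic order is generated by squarefree monomials, and consequently I^{(r)}_{m,n,u,v} is a radical ideal. -/
open MvPolynomial

/-- The double determinantal ideal `I^{(r)}_{m,n,u,v}`. -/
noncomputable def doubleDetIdeal (m n r u v : ℕ) (K : Type*) [Field K] :
    Ideal (MvPolynomial (PageVar m n r) K) :=
  Ideal.span
    ({f : MvPolynomial (PageVar m n r) K |
        ∃ (a : Fin u → Fin m) (b : Fin u → Lex (Fin r × Fin n)),
          StrictMono a ∧ StrictMono b ∧ f = ((horizCat m n r K).submatrix a b).det} ∪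
     {f : MvPolynomial (PageVar m n r) K |
        ∃ (a : Fin v → Lex (Fin r × Fin m)) (b : Fin v → Fin n),
          StrictMono a ∧ StrictMono b ∧ f = ((vertCat m n r K).submatrix a b).det})

set_option linter.unusedSectionVars false

section GenericPart

/-- `M` restricted to `R × C` factors through dimension `t`. -/
def Fac {α β L : Type*} [Field L] (M : α → β → L) (R : Set α) (C : Set β) (t : ℕ) : Prop :=
  ∃ (P : α → Fin t → L) (Q : β → Fin t → L), ∀ r ∈ R, ∀ c ∈ C, M r c = ∑ k, P r k * Q c k

/-- A monotone way of arranging the variables into a matrix. -/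
structure IsView {σ α β : Type*} [LinearOrder σ] [LinearOrder α] [LinearOrder β]
    (row : σ → α) (col : σ → β) (e : α → β → σ) : Prop where
  row_e : ∀ r c, row (e r c) = r
  col_e : ∀ r c, col (e r c) = c
  e_rc : ∀ z, e (row z) (col z) = z
  mono_r : ∀ r r' c, r < r' → e r c < e r' c
  mono_c : ∀ r c d, c < d → e r c < e r d

/-- Diagonal order. -/
def DLt {σ α β : Type*} [LinearOrder α] [LinearOrder β]
    (row : σ → α) (col : σ → β) (a b : σ) : Prop := row a < row b ∧ col a < col b

/-- No diagonal chain of length `u` in `F`. -/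
def NoChain {σ α β : Type*} [LinearOrder α] [LinearOrder β]
    (row : σ → α) (col : σ → β) (u : ℕ) (F : Set σ) : Prop :=
  ∀ l : List σ, l.Pairwise (DLt row col) → (∀ z ∈ l, z ∈ F) → l.length ≠ u

/-- Rank conditions on the variables of `s`. -/
def Cond {σ α β L : Type*} [LinearOrder α] [LinearOrder β] [Field L]
    (row : σ → α) (col : σ → β) (e : α → β → σ) (u : ℕ) (F s : Set σ) (x : σ → L) : Prop :=
  ∀ (l : List σ) (t : ℕ) (R : Set α) (C : Set β), l.length + t + 1 = u →
    l.Pairwise (DLt row col) → (∀ z ∈ l, z ∈ F ∧ z ∉ s) →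
    (∀ z ∈ l, (∀ r ∈ R, row z < r) ∧ (∀ c ∈ C, col z < c)) →
    (∀ r ∈ R, ∀ c ∈ C, e r c ∈ s) → Fac (fun r c => x (e r c)) R C t

variable {σ α β L : Type*} [LinearOrder σ] [LinearOrder α] [LinearOrder β] [Field L]
  {row : σ → α} {col : σ → β} {e : α → β → σ} {u : ℕ} {F s : Set σ}

theorem IsView.swap (hv : IsView row col e) : IsView col row (fun c r => e r c) :=
  ⟨fun r c => hv.col_e c r, fun r c => hv.row_e c r, hv.e_rc,
    fun r r' c h => hv.mono_c c r r' h, fun r c c' h => hv.mono_r c c' r h⟩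

theorem IsView.mono (hv : IsView row col e) {r r' : α} {c c' : β} (h : r ≤ r') (h' : c ≤ c') :
    e r c ≤ e r' c' := by
  have h1 : e r c ≤ e r' c := by
    rcases h.eq_or_lt with rfl | h
    · exact le_rfl
    · exact (hv.mono_r _ _ _ h).le
  have h2 : e r' c ≤ e r' c' := by
    rcases h'.eq_or_lt with rfl | h
    · exact le_rfl
    · exact (hv.mono_c _ _ _ h).le
  exact h1.trans h2

theorem IsView.lt_c (hv : IsView row col e) {y : σ} {c : β} (h : y < e (row y) c) : col y < c := by
  by_contra hc
  have := hv.mono (le_refl (row y)) (not_lt.1 hc)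
  rw [hv.e_rc] at this
  exact absurd h (not_lt.2 this)

theorem IsView.lt_r (hv : IsView row col e) {y : σ} {r : α} (h : y < e r (col y)) : row y < r :=
  hv.swap.lt_c h

theorem Cond.swap {x : σ → L} (h : Cond row col e u F s x) :
    Cond col row (fun c r => e r c) u F s x := by
  intro l t R C h1 h2 h3 h4 h5
  obtain ⟨P, Q, hPQ⟩ := h l t C R h1 (h2.imp fun h => ⟨h.2, h.1⟩) h3
    (fun z hz => ⟨(h4 z hz).2, (h4 z hz).1⟩) (fun r hr c hc => h5 c hc r hr)
  exact ⟨Q, P, fun r hr c hc => (hPQ c hc r hr).trans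
    (Finset.sum_congr rfl fun k _ => mul_comm _ _)⟩

theorem Cond.map {L' : Type*} [Field L'] (ι : L →+* L') {x : σ → L}
    (h : Cond row col e u F s x) : Cond row col e u F s (fun z => ι (x z)) := by
  intro l t R C h1 h2 h3 h4 h5
  obtain ⟨P, Q, hPQ⟩ := h l t R C h1 h2 h3 h4 h5
  refine ⟨fun r k => ι (P r k), fun c k => ι (Q c k), fun r hr c hc => ?_⟩
  have := hPQ r hr c hc
  simp only at this ⊢
  rw [this, map_sum]
  simp

/-- Column operations among later columns preserve the conditions. -/
theorem Cond.colop (hv : IsView row col e) {x x1 : σ → L} (h : Cond row col e u F s x)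
    (γ : β → L) (φ : β → β) (hφ : ∀ c, γ c ≠ 0 → ∀ z, z ∉ s → col z < φ c)
    (hx1 : ∀ r c, e r c ∈ s → x1 (e r c) = x (e r c) + γ c * x (e r (φ c))) :
    Cond row col e u F s x1 := by
  intro l t R C h1 h2 h3 h4 h5
  obtain ⟨P, Q, hPQ⟩ := h l t R (C ∪ {c' | ∃ c ∈ C, γ c ≠ 0 ∧ c' = φ c}) h1 h2 h3
    (fun z hz => ⟨(h4 z hz).1, by
      rintro c (hc | ⟨c, hc, h0, rfl⟩)
      · exact (h4 z hz).2 c hc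
      · exact hφ c h0 z (h3 z hz).2⟩)
    (by
      rintro r hr c (hc | ⟨c, hc, h0, rfl⟩)
      · exact h5 r hr c hc
      · by_contra hn
        have := hφ c h0 _ hn
        rw [hv.col_e] at this
        exact lt_irrefl _ this)
  refine ⟨P, fun c k => Q c k + γ c * Q (φ c) k, fun r hr c hc => ?_⟩
  simp only
  rw [hx1 r c (h5 r hr c hc)]
  have e1 := hPQ r hr c (Or.inl hc)
  simp only at e1
  rw [e1]
  by_cases h0 : γ c = 0
  · simp [h0]
  · have e2 := hPQ r hr (φ c) (Or.inr ⟨c, hc, h0, rfl⟩)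
    simp only at e2
    rw [e2, Finset.mul_sum, ← Finset.sum_add_distrib]
    exact Finset.sum_congr rfl fun k _ => by ring

/-- The step at a variable of `F`. -/
theorem Cond.stepC (hv : IsView row col e) {x1 x2 : σ → L} {y : σ}
    (hs : ∀ z, z ∈ s ↔ y < z) (hyF : y ∈ F) (hF : NoChain row col u F)
    (h : Cond row col e u F s x1) {ε Y : L} (hε : ε * Y = 1) (hy : x2 y = Y)
    (hx2 : ∀ r c, y < e r c → x2 (e r c) = x1 (e r c) +
      if row y < r ∧ col y < c then ε * (x1 (e r (col y)) * x1 (e (row y) c)) else 0) :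
    Cond row col e u F (insert y s) x2 := by
  intro l t R C h1 h2 h3 h4 h5
  have h3' : ∀ z ∈ l, z ∈ F ∧ z ∉ s := fun z hz =>
    ⟨(h3 z hz).1, fun h => (h3 z hz).2 (Or.inr h)⟩
  have hlty : ∀ z ∈ l, z < y := by
    intro z hz
    have := (h3 z hz).2
    by_contra hn
    apply this
    rcases (not_lt.1 hn).eq_or_lt with h | h
    · exact Or.inl h.symm
    · exact Or.inr ((hs z).2 h)
  have hge : ∀ r ∈ R, ∀ c ∈ C, y ≤ e r c := by
    intro r hr c hc
    rcases h5 r hr c hc with h | h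
    · exact h.ge
    · exact ((hs _).1 h).le
  -- row operation
  have rowop : (∀ z ∈ l, row z < row y) → (∀ c ∈ C, col y < c) →
      Fac (fun r c => x2 (e r c)) R C t := by
    intro hz hc
    have hin : ∀ r ∈ insert (row y) R, ∀ c ∈ C, y < e r c := by
      rintro r (rfl | hr) c hcC
      · have := hv.mono_c (row y) _ _ (hc c hcC)
        rwa [hv.e_rc] at this
      · rcases (hge r hr c hcC).eq_or_lt with h | h
        · have := congrArg col h
          rw [hv.col_e] at this
          exact absurd (hc c hcC) (by rw [this]; exact lt_irrefl _)
        · exact h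
    obtain ⟨P, Q, hPQ⟩ := h l t (insert (row y) R) C h1 h2 h3'
      (fun z hzl => ⟨by
        rintro r (rfl | hr)
        · exact hz z hzl
        · exact (h4 z hzl).1 r hr, (h4 z hzl).2⟩)
      (fun r hr c hcC => (hs _).2 (hin r hr c hcC))
    refine ⟨fun r k => P r k + (if row y < r then ε * x1 (e r (col y)) else 0) * P (row y) k, Q,
      fun r hr c hcC => ?_⟩
    simp only
    rw [hx2 r c (hin r (Or.inr hr) c hcC)]
    have e1 := hPQ r (Or.inr hr) c hcC
    have e2 := hPQ (row y) (Or.inl rfl) c hcC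
    simp only at e1 e2
    rw [e1, e2]
    by_cases hr' : row y < r
    · simp only [hr', hc c hcC, and_self, if_true]
      rw [Finset.mul_sum, Finset.mul_sum, ← Finset.sum_add_distrib]
      exact Finset.sum_congr rfl fun k _ => by ring
    · simp [hr']
  have colop : (∀ z ∈ l, col z < col y) → (∀ r ∈ R, row y < r) →
      Fac (fun r c => x2 (e r c)) R C t := by
    intro hz hc
    have hin : ∀ r ∈ R, ∀ c ∈ insert (col y) C, y < e r c := by
      rintro r hr c (rfl | hcC)
      · have := hv.mono_r _ _ (col y) (hc r hr)
        rwa [hv.e_rc] at this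
      · rcases (hge r hr c hcC).eq_or_lt with h | h
        · have := congrArg row h
          rw [hv.row_e] at this
          exact absurd (hc r hr) (by rw [this]; exact lt_irrefl _)
        · exact h
    obtain ⟨P, Q, hPQ⟩ := h l t R (insert (col y) C) h1 h2 h3'
      (fun z hzl => ⟨(h4 z hzl).1, by
        rintro r (rfl | hr)
        · exact hz z hzl
        · exact (h4 z hzl).2 r hr⟩)
      (fun r hr c hcC => (hs _).2 (hin r hr c hcC))
    refine ⟨P, fun c k => Q c k + (if col y < c then ε * x1 (e (row y) c) else 0) * Q (col y) k,
      fun r hr c hcC => ?_⟩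
    simp only
    rw [hx2 r c (hin r hr c (Or.inr hcC))]
    have e1 := hPQ r hr c (Or.inr hcC)
    have e2 := hPQ r hr (col y) (Or.inl rfl)
    simp only at e1 e2
    rw [e1, e2]
    by_cases hr' : col y < c
    · simp only [hr', hc r hr, and_self, if_true]
      rw [Finset.sum_mul, Finset.mul_sum, ← Finset.sum_add_distrib]
      exact Finset.sum_congr rfl fun k _ => by ring
    · simp [hr']
  by_cases hr0 : row y ∈ R
  · have hCge : ∀ c ∈ C, c ≠ col y → col y < c := by
      intro c hc hne
      apply hv.lt_c
      rcases (hge _ hr0 c hc).eq_or_lt with h | h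
      · exact absurd (by have := congrArg col h; rw [hv.col_e] at this; exact this.symm) hne
      · exact h
    by_cases hc0 : col y ∈ C
    · -- the rectangle contains `y`
      have hRge : ∀ r ∈ R, r ≠ row y → row y < r := by
        intro r hr hne
        apply hv.lt_r
        rcases (hge r hr _ hc0).eq_or_lt with h | h
        · exact absurd (by have := congrArg row h; rw [hv.row_e] at this; exact this.symm) hne
        · exact h
      have hpw : (l ++ [y]).Pairwise (DLt row col) := by
        rw [List.pairwise_append]
        refine ⟨h2, List.pairwise_singleton _ _, fun a ha b hb => ?_⟩
        rw [List.mem_singleton] at hb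
        subst hb
        exact ⟨(h4 a ha).1 _ hr0, (h4 a ha).2 _ hc0⟩
      have hmem : ∀ z ∈ l ++ [y], z ∈ F ∧ z ∉ s := by
        intro z hz
        rw [List.mem_append, List.mem_singleton] at hz
        rcases hz with hz | rfl
        · exact h3' z hz
        · exact ⟨hyF, fun h => lt_irrefl _ ((hs _).1 h)⟩
      obtain _ | t := t
      · exact absurd (by simpa using h1) (hF _ hpw fun z hz => (hmem z hz).1)
      obtain ⟨P, Q, hPQ⟩ := h (l ++ [y]) t (R \ {row y}) (C \ {col y})
        (by rw [List.length_append, List.length_singleton]; omega) hpw hmem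
        (by
          intro z hz
          rw [List.mem_append, List.mem_singleton] at hz
          rcases hz with hz | rfl
          · exact ⟨fun r hr => (h4 z hz).1 r hr.1, fun c hc => (h4 z hz).2 c hc.1⟩
          · exact ⟨fun r hr => hRge r hr.1 hr.2, fun c hc => hCge c hc.1 hc.2⟩)
        (by
          intro r hr c hc
          rcases h5 r hr.1 c hc.1 with h | h
          · exact absurd (show r ∈ ({row y} : Set α) by rw [← h, hv.row_e]; rfl) hr.2
          · exact h)
      refine ⟨fun r => Fin.cons (if r = row y then Y else x1 (e r (col y)))
          (fun k => if r = row y then 0 else P r k),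
        fun c => Fin.cons (if c = col y then 1 else ε * x1 (e (row y) c))
          (fun k => if c = col y then 0 else Q c k), fun r hr c hc => ?_⟩
      simp only [Fin.sum_univ_succ, Fin.cons_zero, Fin.cons_succ]
      by_cases hr1 : r = row y <;> by_cases hc1 : c = col y
      · subst hr1 hc1
        simp [hv.e_rc, hy]
      · subst hr1
        have hlt : y < e (row y) c := by
          have := hv.mono_c (row y) _ _ (hCge c hc hc1)
          rwa [hv.e_rc] at this
        rw [hx2 _ _ hlt]
        simp only [hc1, if_true, if_false, lt_irrefl, false_and, zero_mul,
          Finset.sum_const_zero, add_zero]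
        rw [← mul_assoc, mul_comm Y, hε, one_mul]
      · subst hc1
        have hlt : y < e r (col y) := by
          have := hv.mono_r _ _ (col y) (hRge r hr hr1)
          rwa [hv.e_rc] at this
        rw [hx2 _ _ hlt]
        simp [hr1]
      · have hlt : y < e r c := by
          have := hv.mono_r _ _ (col y) (hRge r hr hr1)
          rw [hv.e_rc] at this
          exact this.trans (hv.mono_c _ _ _ (hCge c hc hc1))
        have e1 := hPQ r ⟨hr, hr1⟩ c ⟨hc, hc1⟩
        simp only at e1
        rw [hx2 _ _ hlt, e1]
        simp only [hr1, hc1, if_false, hRge r hr hr1, hCge c hc hc1, and_self, if_true]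
        ring
    · refine rowop (fun z hz => (h4 z hz).1 _ hr0) fun c hc => hCge c hc ?_
      rintro rfl
      exact hc0 hc
  · by_cases hc0 : col y ∈ C
    · refine colop (fun z hz => (h4 z hz).2 _ hc0) fun r hr => ?_
      apply hv.lt_r
      rcases (hge r hr _ hc0).eq_or_lt with h | h
      · exact absurd (by have := congrArg row h; rw [hv.row_e] at this; rwa [this]) hr0
      · exact h
    · have hne : ∀ r ∈ R, ∀ c ∈ C, y < e r c := by
        intro r hr c hc
        rcases (hge r hr c hc).eq_or_lt with h | h
        · exact absurd (by have := congrArg row h; rw [hv.row_e] at this; rwa [this]) hr0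
        · exact h
      by_cases hlow : ∃ r ∈ R, r < row y
      · obtain ⟨r, hr, hlt⟩ := hlow
        refine rowop (fun z hz => ((h4 z hz).1 r hr).trans hlt) fun c hc => ?_
        by_contra hn
        have := hv.mono hlt.le (not_lt.1 hn)
        rw [hv.e_rc] at this
        exact absurd (hne r hr c hc) (not_lt.2 this)
      · have hR : ∀ r ∈ R, row y < r := by
          intro r hr
          by_contra hn
          rcases (not_lt.1 hn).eq_or_lt with h | h
          · exact hr0 (h ▸ hr)
          · exact hlow ⟨r, hr, h⟩
        by_cases hcz : ∀ z ∈ l, col z < col y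
        · exact colop hcz hR
        · push Not at hcz
          obtain ⟨z, hz, hzc⟩ := hcz
          have key : ∀ z ∈ l, col y ≤ col z → row z < row y := by
            intro z hz hzc
            by_contra hn
            have := hv.mono (not_lt.1 hn) hzc
            rw [hv.e_rc, hv.e_rc] at this
            exact absurd (hlty z hz) (not_lt.2 this)
          refine rowop (fun z' hz' => ?_) fun c hc => hzc.trans_lt ((h4 z hz).2 c hc)
          by_cases hc' : col y ≤ col z'
          · exact key z' hz' hc'
          · have hlt : col z' < col z := (not_le.1 hc').trans_le hzc
            have hcmp : DLt row col z' z ∨ DLt row col z z' := by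
              obtain ⟨i, hi⟩ := List.mem_iff_get.1 hz'
              obtain ⟨j, hj⟩ := List.mem_iff_get.1 hz
              have hget := List.pairwise_iff_get.1 h2
              rcases lt_trichotomy i j with hij | hij | hij
              · left
                rw [← hi, ← hj]
                exact hget i j hij
              · exfalso
                rw [← hi, ← hj, hij] at hlt
                exact lt_irrefl _ hlt
              · right
                rw [← hi, ← hj]
                exact hget j i hij
            rcases hcmp with h | h
            · exact h.1.trans (key z hz hzc)
            · exact absurd h.2 (not_lt.2 hlt.le)

/-- The step at a variable outside `F`, when its row is a combination of later rows. -/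
theorem Cond.stepN (hv : IsView row col e) {x : σ → L} {y : σ}
    (hs : ∀ z, z ∈ s ↔ y < z) (h : Cond row col e u F s x) {n : ℕ} (lam : Fin n → L)
    (ρ : Fin n → α) (hρ : ∀ k, row y < ρ k)
    (hx : ∀ c, col y ≤ c → x (e (row y) c) = ∑ k, lam k * x (e (ρ k) c)) :
    Cond row col e u F (insert y s) x := by
  intro l t R C h1 h2 h3 h4 h5
  have h3' : ∀ z ∈ l, z ∈ F ∧ z ∉ s := fun z hz =>
    ⟨(h3 z hz).1, fun h => (h3 z hz).2 (Or.inr h)⟩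
  by_cases hin : row y ∈ R ∧ col y ∈ C
  · have hge : ∀ r ∈ R, ∀ c ∈ C, y ≤ e r c := by
      intro r hr c hc
      rcases h5 r hr c hc with h | h
      · exact h.ge
      · exact ((hs _).1 h).le
    have hCge : ∀ c ∈ C, col y ≤ c := by
      intro c hc
      rcases (hge _ hin.1 c hc).eq_or_lt with h | h
      · have := congrArg col h; rw [hv.col_e] at this; exact this.le
      · exact (hv.lt_c h).le
    have hRge : ∀ r ∈ R, row y ≤ r := by
      intro r hr
      rcases (hge r hr _ hin.2).eq_or_lt with h | h
      · have := congrArg row h; rw [hv.row_e] at this; exact this.le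
      · exact (hv.lt_r h).le
    obtain ⟨P, Q, hPQ⟩ := h l t {r | row y < r} {c | col y ≤ c} h1 h2 h3'
      (fun z hz => ⟨fun r hr => ((h4 z hz).1 _ hin.1).trans hr,
        fun c hc => ((h4 z hz).2 _ hin.2).trans_le hc⟩)
      (fun r hr c hc => by
        rw [hs]
        have := hv.mono_r _ _ (col y) hr
        rw [hv.e_rc] at this
        exact this.trans_le (hv.mono le_rfl hc))
    refine ⟨fun r k => if r = row y then ∑ i, lam i * P (ρ i) k else P r k, Q, ?_⟩
    intro r hr c hc
    simp only
    by_cases hr1 : r = row y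
    · subst hr1
      rw [hx c (hCge c hc)]
      simp only [if_true, Finset.sum_mul]
      rw [Finset.sum_comm]
      refine Finset.sum_congr rfl fun i _ => ?_
      have e1 := hPQ (ρ i) (hρ i) c (hCge c hc)
      simp only at e1
      rw [e1, Finset.mul_sum]
      exact Finset.sum_congr rfl fun k _ => by ring
    · simp only [hr1, if_false]
      exact hPQ r (lt_of_le_of_ne (hRge r hr) (Ne.symm hr1)) c (hCge c hc)
  · refine h l t R C h1 h2 h3' h4 fun r hr c hc => ?_
    rcases h5 r hr c hc with h | h
    · exact absurd ⟨by rw [← h, hv.row_e]; exact hr, by rw [← h, hv.col_e]; exact hc⟩ hin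
    · exact h

theorem Cond.congr {x x' : σ → L} (h : Cond row col e u F s x) (hx : ∀ z ∈ s, x' z = x z) :
    Cond row col e u F s x' := by
  intro l t R C h1 h2 h3 h4 h5
  obtain ⟨P, Q, hPQ⟩ := h l t R C h1 h2 h3 h4 h5
  exact ⟨P, Q, fun r hr c hc => (hx _ (h5 r hr c hc)).trans (hPQ r hr c hc)⟩

/-- All minors of size `u` vanish at the end. -/
theorem Cond.det_eq_zero {x : σ → L} (h : Cond row col e u F Set.univ x) (hu : 1 ≤ u)
    (a : Fin u → α) (b : Fin u → β) :
    (Matrix.of fun i j => x (e (a i) (b j))).det = 0 := by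
  obtain _ | t := u
  · omega
  obtain ⟨P, Q, hPQ⟩ := h [] t Set.univ Set.univ (by simp) List.Pairwise.nil (by simp) (by simp)
    (by simp)
  have : (Matrix.of fun i j => x (e (a i) (b j))) =
      (Matrix.of fun i k => P (a i) k) * (Matrix.of fun k j => Q (b j) k) := by
    ext i j
    simp [Matrix.mul_apply, hPQ (a i) trivial (b j) trivial]
  rw [this]
  by_contra hne
  have h1 := Matrix.rank_of_isUnit _ ((Matrix.isUnit_iff_isUnit_det _).2 (isUnit_iff_ne_zero.2 hne))
  have h2 := (Matrix.rank_mul_le_left (Matrix.of fun i k => P (a i) k)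
    (Matrix.of fun k j => Q (b j) k)).trans (Matrix.rank_le_width _)
  simp at h1
  omega

end GenericPart

section PolyPart

/-- Lexicographic comparison of exponents, smaller indices being more significant. -/
def LexLt {σ : Type*} [LinearOrder σ] (w' w : σ →₀ ℕ) : Prop :=
  ∃ z, w' z < w z ∧ ∀ y < z, w' y = w y

/-- Nonvanishing at `x` of polynomials with leading exponent supported in `F` on `s`. -/
def HProp {σ K L : Type*} [LinearOrder σ] [Field K] [Field L] [Algebra K L]
    (F s : Set σ) (x : σ → L) : Prop :=
  (∀ z, z ∉ s → x z = 1) ∧ ∀ (f : MvPolynomial σ K) (w : σ →₀ ℕ), w ∈ f.support →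
    (∀ w' ∈ f.support, ∀ z, z ∉ s → w' z = w z) → (∀ z ∈ s, z ∉ F → w z = 0) →
    (∀ w' ∈ f.support, w' = w ∨ LexLt w' w) → aeval x f ≠ 0

variable {σ K L : Type*} [LinearOrder σ] [Field K] [Field L] [Algebra K L]

theorem sum_single_apply {t : ℕ} (g : Fin t → σ) (z : σ) :
    (∑ i, Finsupp.single (g i) 1 : σ →₀ ℕ) z = ∑ i, if g i = z then 1 else 0 := by
  classical
  simp [Finsupp.finsetSum_apply, Finsupp.single_apply]

theorem lexLt_perm {t : ℕ} (M : Fin t → Fin t → σ)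
    (hr : ∀ i i' j, i < i' → M i j < M i' j) (hc : ∀ i j j', j < j' → M i j < M i j')
    (π : Equiv.Perm (Fin t)) (hπ : π ≠ 1) :
    LexLt (∑ i, Finsupp.single (M (π i) i) 1) (∑ i, Finsupp.single (M i i) 1) := by
  have hm : ∀ i i' j j', i ≤ i' → j ≤ j' → M i j ≤ M i' j' := by
    intro i i' j j' h h'
    have h1 : M i j ≤ M i' j := by
      rcases h.eq_or_lt with rfl | h
      · exact le_rfl
      · exact (hr _ _ _ h).le
    have h2 : M i' j ≤ M i' j' := by
      rcases h'.eq_or_lt with rfl | h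
      · exact le_rfl
      · exact (hc _ _ _ h).le
    exact h1.trans h2
  have hne : (Finset.univ.filter fun i => π i ≠ i).Nonempty := by
    by_contra h
    apply hπ
    ext i
    by_contra hi
    apply h
    refine ⟨i, ?_⟩
    simp only [Finset.mem_filter, Finset.mem_univ, true_and]
    intro h'
    rw [h'] at hi
    exact hi rfl
  obtain ⟨i0, hi0, hmin⟩ := Finset.exists_min_image _ id hne
  simp only [Finset.mem_filter, Finset.mem_univ, true_and, id] at hi0 hmin
  have key : ∀ i, π i ≠ i → M i0 i0 < M (π i) i := by
    intro i hi
    have h1 := hmin i hi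
    have h2 := hmin (π i) (fun h => hi (π.injective h))
    rcases h1.eq_or_lt with h | h
    · subst h
      exact hr _ _ _ (lt_of_le_of_ne h2 (Ne.symm hi))
    · exact lt_of_lt_of_le (hc i0 i0 i h) (hm _ _ _ _ h2 le_rfl)
  refine ⟨M i0 i0, ?_, fun z hz => ?_⟩
  · rw [sum_single_apply, sum_single_apply]
    apply Finset.sum_lt_sum
    · intro i _
      by_cases hi : π i = i
      · rw [hi]
      · rw [if_neg (key i hi).ne']
        exact Nat.zero_le _
    · refine ⟨i0, Finset.mem_univ _, ?_⟩
      rw [if_neg (key i0 hi0).ne', if_pos rfl]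
      exact one_pos
  · rw [sum_single_apply, sum_single_apply]
    refine Finset.sum_congr rfl fun i _ => ?_
    by_cases hi : π i = i
    · rw [hi]
    · rw [if_neg (hz.trans (key i hi)).ne',
        if_neg (hz.trans_le (hm _ _ _ _ (hmin i hi) (hmin i hi))).ne']

theorem LexLt.ne {w' w : σ →₀ ℕ} (h : LexLt w' w) : w' ≠ w := by
  rintro rfl
  obtain ⟨z, hz, _⟩ := h
  exact lt_irrefl _ hz

theorem det_eq_sum {t : ℕ} (M : Fin t → Fin t → σ) :
    (Matrix.of fun i j => (X (M i j) : MvPolynomial σ K)).det =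
      ∑ π : Equiv.Perm (Fin t),
        monomial (∑ i, Finsupp.single (M (π i) i) 1) ((Equiv.Perm.sign π : ℤ) : K) := by
  rw [Matrix.det_apply]
  refine Finset.sum_congr rfl fun π _ => ?_
  have : ∏ i, (X (M (π i) i) : MvPolynomial σ K) =
      monomial (∑ i, Finsupp.single (M (π i) i) 1) 1 := by
    rw [monomial_sum_one]
    rfl
  simp only [Matrix.of_apply]
  rw [this, Units.smul_def, ← Int.cast_smul_eq_zsmul K, smul_monomial, smul_eq_mul, mul_one]

theorem det_support {t : ℕ} (M : Fin t → Fin t → σ)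
    (w' : σ →₀ ℕ) (h : w' ∈ (Matrix.of fun i j => (X (M i j) : MvPolynomial σ K)).det.support) :
    ∃ π : Equiv.Perm (Fin t), w' = ∑ i, Finsupp.single (M (π i) i) 1 := by
  rw [det_eq_sum, mem_support_iff, coeff_sum] at h
  obtain ⟨π, _, hπ⟩ := Finset.exists_ne_zero_of_sum_ne_zero h
  rw [coeff_monomial] at hπ
  refine ⟨π, ?_⟩
  by_contra hne
  rw [if_neg (Ne.symm hne)] at hπ
  exact hπ rfl

theorem det_support_lexLt {t : ℕ} (M : Fin t → Fin t → σ)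
    (hr : ∀ i i' j, i < i' → M i j < M i' j) (hc : ∀ i j j', j < j' → M i j < M i j')
    (w' : σ →₀ ℕ) (h : w' ∈ (Matrix.of fun i j => (X (M i j) : MvPolynomial σ K)).det.support) :
    w' = ∑ i, Finsupp.single (M i i) 1 ∨ LexLt w' (∑ i, Finsupp.single (M i i) 1) := by
  obtain ⟨π, rfl⟩ := det_support M w' h
  by_cases hπ : π = 1
  · left; rw [hπ]; rfl
  · exact Or.inr (lexLt_perm M hr hc π hπ)

theorem det_coeff {t : ℕ} (M : Fin t → Fin t → σ)
    (hr : ∀ i i' j, i < i' → M i j < M i' j) (hc : ∀ i j j', j < j' → M i j < M i j') :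
    coeff (∑ i, Finsupp.single (M i i) 1)
      (Matrix.of fun i j => (X (M i j) : MvPolynomial σ K)).det = 1 := by
  rw [det_eq_sum, coeff_sum, Finset.sum_eq_single 1]
  · simp
  · intro π _ hπ
    rw [coeff_monomial, if_neg (lexLt_perm M hr hc π hπ).ne]
  · simp

theorem HProp.stepN [Finite σ] {F s : Set σ} {x : σ → L} {y : σ} (hs : ∀ z, z ∈ s ↔ y < z)
    (hyF : y ∉ F) (h : HProp (K := K) F s x) (a : L) :
    HProp (K := K) F (insert y s) (Function.update x y a) := by
  refine ⟨fun z hz => ?_, fun f w hw h1 h2 h3 => ?_⟩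
  · rw [Function.update_of_ne (fun h => hz (Or.inl h))]
    exact h.1 z fun h => hz (Or.inr h)
  · have hw0 := h2 y (Or.inl rfl) hyF
    have hw' : ∀ w' ∈ f.support, w' y = 0 := by
      intro w' hw'
      rcases h3 w' hw' with rfl | ⟨z, hz, hz'⟩
      · exact hw0
      · rcases lt_trichotomy z y with hlt | rfl | hlt
        · have : z ∉ insert y s := by
            rintro (h | h)
            · exact hlt.ne h
            · exact absurd hlt (not_lt.2 ((hs z).1 h).le)
          rw [h1 w' hw' z this] at hz
          exact absurd hz (lt_irrefl _)
        · omega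
        · rw [hz' y hlt, hw0]
    have e1 : aeval (Function.update x y a) f = aeval x f := by
      have := Fintype.ofFinite σ
      rw [aeval_def, aeval_def, eval₂_eq', eval₂_eq']
      refine Finset.sum_congr rfl fun w' hw'' => ?_
      congr 1
      refine Finset.prod_congr rfl fun z _ => ?_
      by_cases hz : z = y
      · rw [hz, hw' w' hw'']; simp
      · rw [Function.update_of_ne hz]
    rw [e1]
    refine h.2 f w hw (fun w' hw'' z hz => ?_) (fun z hz => h2 z (Or.inr hz)) h3
    by_cases hzy : z = y
    · rw [hzy, hw' w' hw'', hw0]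
    · exact h1 w' hw'' z (by rintro (h | h); exacts [hzy h, hz h])

theorem HProp.stepC [Finite σ] {F s : Set σ} {x : σ → L} {y : σ} (hs : ∀ z, z ∈ s ↔ y < z)
    (h : HProp (K := K) F s x) (x2 : σ → RatFunc L) (hy : x2 y = RatFunc.X⁻¹)
    (p : σ → Polynomial L) (hp : ∀ z, z ≠ y → x2 z = algebraMap _ _ (p z))
    (hp0 : ∀ z, z ≠ y → (p z).eval 0 = x z) (h1 : ∀ z, z ∉ insert y s → x2 z = 1) :
    HProp (K := K) F (insert y s) x2 := by
  classical
  have := Fintype.ofFinite σ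
  refine ⟨h1, fun f w hw h1 h2 h3 => ?_⟩
  have hle : ∀ w' ∈ f.support, w' y ≤ w y := by
    intro w' hw'
    rcases h3 w' hw' with rfl | ⟨z, hz, hz'⟩
    · exact le_rfl
    · rcases lt_trichotomy z y with hlt | rfl | hlt
      · have : z ∉ insert y s := by
          rintro (h | h)
          · exact hlt.ne h
          · exact absurd hlt (not_lt.2 ((hs z).1 h).le)
        rw [h1 w' hw' z this] at hz
        exact absurd hz (lt_irrefl _)
      · exact hz.le
      · rw [hz' y hlt]
  have hys : y ∉ s := fun h => lt_irrefl _ ((hs y).1 h)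
  set g : MvPolynomial σ K := ∑ w' ∈ f.support.filter (fun w' => w' y = w y),
    monomial w' (coeff w' f) with hg
  have hgc : ∀ w', coeff w' g = if w' y = w y then coeff w' f else 0 := by
    intro w'
    rw [hg, coeff_sum]
    simp only [coeff_monomial]
    rw [Finset.sum_ite_eq']
    by_cases h0 : coeff w' f = 0 <;> simp [h0]
  have hgs : ∀ w', w' ∈ g.support ↔ w' ∈ f.support ∧ w' y = w y := by
    intro w'
    rw [mem_support_iff, hgc, mem_support_iff]
    by_cases h0 : w' y = w y <;> simp [h0]
  have hg0 : aeval x g ≠ 0 := by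
    refine h.2 g w ((hgs w).2 ⟨hw, rfl⟩) (fun w' hw' z hz => ?_) (fun z hz => h2 z (Or.inr hz))
      fun w' hw' => h3 w' ((hgs w').1 hw').1
    by_cases hzy : z = y
    · rw [hzy, ((hgs w').1 hw').2]
    · exact h1 w' ((hgs w').1 hw').1 z (by rintro (h | h); exacts [hzy h, hz h])
  set q : Polynomial L := ∑ w' ∈ f.support, Polynomial.C (algebraMap K L (coeff w' f)) *
    (Polynomial.X ^ (w y - w' y) * ∏ z ∈ Finset.univ.erase y, p z ^ w' z) with hq
  have hq0 : q.eval 0 = aeval x g := by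
    rw [hq, Polynomial.eval_finsetSum, hg, map_sum, Finset.sum_filter]
    refine Finset.sum_congr rfl fun w' hw' => ?_
    simp only [Polynomial.eval_mul, Polynomial.eval_C, Polynomial.eval_pow, Polynomial.eval_X,
      Polynomial.eval_prod]
    by_cases hwy : w' y = w y
    · rw [if_pos hwy, aeval_monomial, hwy, Nat.sub_self, pow_zero, one_mul]
      congr 1
      rw [Finsupp.prod_fintype _ _ (by simp), ← Finset.mul_prod_erase Finset.univ _
        (Finset.mem_univ y), h.1 y hys, one_pow, one_mul]
      exact Finset.prod_congr rfl fun z hz => by rw [hp0 z (Finset.ne_of_mem_erase hz)]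
    · rw [if_neg hwy, zero_pow (by have := hle w' hw'; omega), zero_mul, mul_zero]
  have hqx : algebraMap (Polynomial L) (RatFunc L) q = RatFunc.X ^ (w y) * aeval x2 f := by
    rw [hq, map_sum, aeval_def, eval₂_eq', Finset.mul_sum]
    refine Finset.sum_congr rfl fun w' hw' => ?_
    rw [map_mul, map_mul, map_pow, RatFunc.algebraMap_X, map_prod,
      ← Finset.mul_prod_erase Finset.univ _ (Finset.mem_univ y), hy]
    have e1 : algebraMap (Polynomial L) (RatFunc L) (Polynomial.C (algebraMap K L (coeff w' f))) =
        algebraMap K (RatFunc L) (coeff w' f) := by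
      rw [IsScalarTower.algebraMap_apply K (Polynomial L) (RatFunc L)]
      rfl
    have e2 : (RatFunc.X : RatFunc L) ^ (w y - w' y) = RatFunc.X ^ (w y) * RatFunc.X⁻¹ ^ (w' y) := by
      rw [inv_pow, ← pow_sub₀ _ RatFunc.X_ne_zero (hle w' hw')]
    rw [e1, e2]
    have e3 : ∏ z ∈ Finset.univ.erase y, algebraMap (Polynomial L) (RatFunc L) (p z ^ w' z) =
        ∏ z ∈ Finset.univ.erase y, x2 z ^ w' z :=
      Finset.prod_congr rfl fun z hz => by rw [map_pow, hp z (Finset.ne_of_mem_erase hz)]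
    rw [e3]
    ring
  intro h0
  rw [h0, mul_zero] at hqx
  have : q = 0 := (map_eq_zero_iff _ (RatFunc.algebraMap_injective L)).1 hqx
  rw [this, Polynomial.eval_zero] at hq0
  exact hg0 hq0.symm

variable {α β : Type*} [LinearOrder α] [LinearOrder β]
  {row : σ → α} {col : σ → β} {e : α → β → σ} {u : ℕ} {F s : Set σ}

/-- The row of `y` is a combination of later rows. -/
theorem exists_combination [Finite σ] (hv : IsView row col e) {x : σ → L} {y : σ}
    (hs : ∀ z, z ∈ s ↔ y < z)
    (hC : Cond row col e u F s x) (hP : HProp (K := K) F s x) (l1 l2 : List σ)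
    (hl : (l1 ++ y :: l2).Pairwise (DLt row col)) (hlen : (l1 ++ y :: l2).length = u)
    (h1 : ∀ z ∈ l1, z ∈ F) (h2 : ∀ z ∈ l2, z ∈ F) :
    ∃ (n : ℕ) (lam : Fin n → L) (ρ : Fin n → α), (∀ k, row y < ρ k) ∧
      ∀ c, col y < c → x (e (row y) c) = ∑ k, lam k * x (e (ρ k) c) := by
  rw [List.pairwise_append, List.pairwise_cons] at hl
  obtain ⟨hl1, ⟨hy2, hl2⟩, h12⟩ := hl
  have hl2' := List.pairwise_iff_get.1 hl2
  set t := l2.length with ht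
  have hg : ∀ k : Fin t, DLt row col y (l2.get k) := fun k => hy2 _ (List.get_mem _ _)
  have hlt : ∀ {r c}, row y ≤ r → col y < c → y < e r c := by
    intro r c hr hc
    have := hv.mono_c (row y) _ _ hc
    rw [hv.e_rc] at this
    exact this.trans_le (hv.mono hr le_rfl)
  obtain ⟨P, Q, hPQ⟩ := hC l1 t {r | row y ≤ r} {c | col y < c} (by
      rw [List.length_append, List.length_cons] at hlen; omega) hl1
    (fun z hz => ⟨h1 z hz, fun hzs => by
      have hd := h12 z hz y List.mem_cons_self
      have := hv.mono hd.1.le hd.2.le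
      rw [hv.e_rc, hv.e_rc] at this
      exact absurd ((hs z).1 hzs) (not_lt.2 this)⟩)
    (fun z hz => by
      have hd := h12 z hz y List.mem_cons_self
      exact ⟨fun r hr => hd.1.trans_le hr, fun c hc => hd.2.trans hc⟩)
    (fun r hr c hc => (hs _).2 (hlt hr hc))
  simp only [Set.mem_ofPred_eq] at hPQ
  set M : Fin t → Fin t → σ := fun i j => e (row (l2.get i)) (col (l2.get j)) with hM
  have hMr : ∀ i i' j, i < i' → M i j < M i' j := fun i i' j h => hv.mono_r _ _ _ (hl2' i i' h).1
  have hMc : ∀ i j j', j < j' → M i j < M i j' := fun i j j' h => hv.mono_c _ _ _ (hl2' j j' h).2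
  have hMs : ∀ i j, M i j ∈ s := fun i j => (hs _).2 (hlt (hg i).1.le (hg j).2)
  have hz0 : ∀ (π : Equiv.Perm (Fin t)) z, z ∉ s →
      (∑ i, Finsupp.single (M (π i) i) 1 : σ →₀ ℕ) z = 0 := by
    intro π z hz
    rw [sum_single_apply]
    refine Finset.sum_eq_zero fun i _ => if_neg ?_
    rintro rfl
    exact hz (hMs _ _)
  have hdet := hP.2 (Matrix.of fun i j => (X (M i j) : MvPolynomial σ K)).det
    (∑ i, Finsupp.single (M i i) 1)
    (by rw [mem_support_iff, det_coeff M hMr hMc]; exact one_ne_zero)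
    (fun w' hw' z hz => by
      obtain ⟨π, rfl⟩ := det_support M w' hw'
      rw [hz0 π z hz]
      exact (hz0 1 z hz).symm)
    (fun z _ hzF => by
      rw [sum_single_apply]
      refine Finset.sum_eq_zero fun i _ => if_neg ?_
      rintro rfl
      apply hzF
      have : M i i = l2.get i := hv.e_rc _
      rw [this]
      exact h2 _ (List.get_mem _ _))
    (det_support_lexLt M hMr hMc)
  rw [AlgHom.map_det] at hdet
  set PM : Matrix (Fin t) (Fin t) L := Matrix.of fun i k => P (row (l2.get i)) k with hPM
  have hfac : (aeval x).mapMatrix (Matrix.of fun i j => (X (M i j) : MvPolynomial σ K)) =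
      PM * (Matrix.of fun k j => Q (col (l2.get j)) k) := by
    ext i j
    simp only [AlgHom.mapMatrix_apply, Matrix.map_apply, Matrix.of_apply, aeval_X,
      Matrix.mul_apply, hPM]
    exact hPQ _ (hg i).1.le _ (hg j).2
  rw [hfac, Matrix.det_mul] at hdet
  have hPdet : IsUnit PM.det := isUnit_iff_ne_zero.2 (left_ne_zero_of_mul hdet)
  refine ⟨t, Matrix.vecMul (P (row y)) PM⁻¹, fun k => row (l2.get k), fun k => (hg k).1,
    fun c hc => ?_⟩
  rw [hPQ _ le_rfl c hc]
  have e1 : Matrix.vecMul (Matrix.vecMul (P (row y)) PM⁻¹) PM = P (row y) := by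
    rw [Matrix.vecMul_vecMul, Matrix.nonsing_inv_mul _ hPdet, Matrix.vecMul_one]
  have e2 : ∀ k, P (row y) k = ∑ i, Matrix.vecMul (P (row y)) PM⁻¹ i * P (row (l2.get i)) k := by
    intro k
    conv_lhs => rw [← e1]
    rfl
  have e3 : ∀ i, x (e (row (l2.get i)) c) = ∑ k, P (row (l2.get i)) k * Q c k :=
    fun i => hPQ _ (hg i).1.le c hc
  simp only [e3]
  conv_lhs => enter [2, k]; rw [e2 k, Finset.sum_mul]
  rw [Finset.sum_comm]
  refine Finset.sum_congr rfl fun i _ => ?_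
  rw [Finset.mul_sum]
  exact Finset.sum_congr rfl fun k _ => by ring

end PolyPart

section TwoViews

variable {σ K L : Type*} [LinearOrder σ] [Field K] [Field L] [Algebra K L]
  {α β α' β' : Type*} [LinearOrder α] [LinearOrder β] [LinearOrder α'] [LinearOrder β']
  {row : σ → α} {col : σ → β} {e : α → β → σ} {row' : σ → α'} {col' : σ → β'}
  {e' : α' → β' → σ} {u v : ℕ} {F s : Set σ}

/-- The step at a variable outside `F`, in both views. -/
theorem stepN_both [Finite σ] (hv : IsView row col e) (hv' : IsView row' col' e')
    {x : σ → L} {y : σ} (hs : ∀ z, z ∈ s ↔ y < z)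
    (f : α → β') (g : α' → β) (hfg : ∀ r c, e' c (f r) = e r (g c))
    (hf : StrictMono f) (hg : Monotone g) (hfy : f (row y) = col' y) (hgy : g (row' y) = col y)
    (hC : Cond row col e u F s x) (hC' : Cond row' col' e' v F s x)
    (hP : HProp (K := K) F s x) (hyF : y ∉ F) (hF : NoChain row col u F)
    (hnF : ¬ NoChain row col u (insert y F)) :
    ∃ x' : σ → L, HProp (K := K) F (insert y s) x' ∧ Cond row col e u F (insert y s) x' ∧
      Cond row' col' e' v F (insert y s) x' := by
  unfold NoChain at hnF
  push Not at hnF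
  obtain ⟨l, hl, hlF, hlen⟩ := hnF
  have hyl : y ∈ l := by
    by_contra hyl
    refine hF l hl (fun z hz => ?_) hlen
    rcases hlF z hz with h | h
    · exact absurd (h ▸ hz) hyl
    · exact h
  obtain ⟨l1, l2, rfl⟩ := List.append_of_mem hyl
  have hl' := hl
  rw [List.pairwise_append, List.pairwise_cons] at hl'
  obtain ⟨-, ⟨hy2, -⟩, h12⟩ := hl'
  obtain ⟨n, lam, ρ, hρ, hlam⟩ := exists_combination (K := K) hv hs hC hP l1 l2 hl hlen
    (fun z hz => by
      rcases hlF z (List.mem_append_left _ hz) with h | h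
      · have := (h12 z hz y List.mem_cons_self).1
        rw [h] at this
        exact absurd this (lt_irrefl _)
      · exact h)
    (fun z hz => by
      rcases hlF z (List.mem_append_right _ (List.mem_cons_of_mem _ hz)) with h | h
      · have := (hy2 z hz).1
        rw [h] at this
        exact absurd this (lt_irrefl _)
      · exact h)
  have hys : ∀ z, z ≠ y → Function.update x y (∑ k, lam k * x (e (ρ k) (col y))) z = x z :=
    fun z hz => Function.update_of_ne hz _ _
  have hss : ∀ z ∈ s, Function.update x y (∑ k, lam k * x (e (ρ k) (col y))) z = x z :=
    fun z hz => hys z ((hs z).1 hz).ne'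
  have hcomb : ∀ c, col y ≤ c →
      Function.update x y (∑ k, lam k * x (e (ρ k) (col y))) (e (row y) c) =
      ∑ k, lam k * Function.update x y (∑ k, lam k * x (e (ρ k) (col y))) (e (ρ k) c) := by
    intro c hc
    have e1 : ∀ k, Function.update x y (∑ k, lam k * x (e (ρ k) (col y))) (e (ρ k) c) =
        x (e (ρ k) c) := by
      intro k
      apply hys
      intro h
      have := hρ k
      rw [← h, hv.row_e] at this
      exact lt_irrefl _ this
    simp only [e1]
    rcases hc.eq_or_lt with rfl | hc
    · rw [hv.e_rc, Function.update_self]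
    · rw [← hlam c hc]
      apply hys
      intro h
      rw [← h, hv.col_e] at hc
      exact lt_irrefl _ hc
  refine ⟨Function.update x y (∑ k, lam k * x (e (ρ k) (col y))), hP.stepN hs hyF _,
    (hC.congr hss).stepN hv hs lam ρ hρ hcomb, ?_⟩
  have := ((hC'.congr hss).swap).stepN hv'.swap hs lam (fun k => f (ρ k))
    (fun k => by rw [← hfy]; exact hf (hρ k))
    (fun c hc => by
      rw [← hfy]
      simp only [hfg]
      exact hcomb (g c) (by rw [← hgy]; exact hg hc))
  exact this.swap

end TwoViews

universe uK

section Concrete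

variable {m n r : ℕ}

/-- The variable with page `p`, row `i`, column `j`. -/
def pv (p : Fin r) (i : Fin m) (j : Fin n) : PageVar m n r := toLex (p, toLex (i, j))

def rowA (z : PageVar m n r) : Fin m := (ofLex (ofLex z).2).1
def colA (z : PageVar m n r) : Lex (Fin r × Fin n) := toLex ((ofLex z).1, (ofLex (ofLex z).2).2)
def eA (i : Fin m) (c : Lex (Fin r × Fin n)) : PageVar m n r := pv (ofLex c).1 i (ofLex c).2
def rowB (z : PageVar m n r) : Fin n := (ofLex (ofLex z).2).2
def colB (z : PageVar m n r) : Lex (Fin r × Fin m) := toLex ((ofLex z).1, (ofLex (ofLex z).2).1)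
def eB (j : Fin n) (c : Lex (Fin r × Fin m)) : PageVar m n r := pv (ofLex c).1 (ofLex c).2 j

theorem pv_lt_s12 {p p' : Fin r} {i i' : Fin m} {j j' : Fin n} :
    (pv p i j : PageVar m n r) < pv p' i' j' ↔
      p < p' ∨ p = p' ∧ (i < i' ∨ i = i' ∧ j < j') := by
  simp [pv, Prod.Lex.toLex_lt_toLex]

theorem viewA : IsView (rowA (m := m) (n := n) (r := r)) colA eA where
  row_e _ _ := rfl
  col_e _ _ := rfl
  e_rc _ := rfl
  mono_r i i' c h := pv_lt_s12.2 (Or.inr ⟨rfl, Or.inl h⟩)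
  mono_c i c c' h := by
    rcases Prod.Lex.lt_iff.1 h with h | ⟨h, h'⟩
    · exact pv_lt_s12.2 (Or.inl h)
    · exact pv_lt_s12.2 (Or.inr ⟨h, Or.inr ⟨rfl, h'⟩⟩)

theorem viewB : IsView (rowB (m := m) (n := n) (r := r)) colB eB where
  row_e _ _ := rfl
  col_e _ _ := rfl
  e_rc _ := rfl
  mono_r j j' c h := pv_lt_s12.2 (Or.inr ⟨rfl, Or.inr ⟨rfl, h⟩⟩)
  mono_c i c c' h := by
    rcases Prod.Lex.lt_iff.1 h with h | ⟨h, h'⟩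
    · exact pv_lt_s12.2 (Or.inl h)
    · exact pv_lt_s12.2 (Or.inr ⟨h, Or.inl h'⟩)

variable {L : Type*} [Field L] {u v : ℕ} {F s : Set (PageVar m n r)}

/-- Transition formulas at a variable of `F`. -/
def PTrans (p : Fin r) (i : Fin m) (j : Fin n) (ε : L) (x x2 : PageVar m n r → L) : Prop :=
  (∀ i' j', pv p i j < pv p i' j' → x2 (pv p i' j') = x (pv p i' j') +
    if i < i' ∧ j < j' then ε * (x (pv p i' j) * x (pv p i j')) else 0) ∧
  (∀ k i' j', p < k → x2 (pv k i' j') =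
    (x (pv k i' j') + (if j < j' then ε * x (pv p i j') else 0) * x (pv k i' j)) +
    (if i < i' then ε * x (pv p i' j) else 0) *
      (x (pv k i j') + (if j < j' then ε * x (pv p i j') else 0) * x (pv k i j)))

theorem stepC_A {p : Fin r} {i : Fin m} {j : Fin n} {ε Y : L} {x x2 : PageVar m n r → L}
    (hT : PTrans p i j ε x x2) (hs : ∀ z, z ∈ s ↔ pv p i j < z) (hyF : pv p i j ∈ F)
    (hF : NoChain rowA colA u F) (h : Cond rowA colA eA u F s x) (hε : ε * Y = 1)
    (hy : x2 (pv p i j) = Y) : Cond rowA colA eA u F (insert (pv p i j) s) x2 := by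
  set γ : Lex (Fin r × Fin n) → L := fun c =>
    if p < (ofLex c).1 then (if j < (ofLex c).2 then ε * x (pv p i (ofLex c).2) else 0) else 0
    with hγ
  have h1 := Cond.colop viewA (x1 := fun z => x z + γ (colA z) *
      x (eA (rowA z) (toLex ((ofLex (colA z)).1, j)))) h γ (fun c => toLex ((ofLex c).1, j))
    (by
      intro c hc z hz
      rw [hs] at hz
      have hp : p < (ofLex c).1 := by
        by_contra hp
        exact hc (by simp only [hγ, if_neg hp])
      have hz' : (ofLex z).1 ≤ p := by
        by_contra hn
        exact hz (pv_lt_s12 (p' := (ofLex z).1) (i' := rowA z) (j' := rowB z).2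
          (Or.inl (not_le.1 hn)))
      exact Prod.Lex.lt_iff.2 (Or.inl (hz'.trans_lt hp)))
    (by intro i' c _; rfl)
  refine Cond.stepC viewA hs hyF hF h1 hε hy ?_
  intro i' c hlt
  obtain ⟨k, j'⟩ := c
  change pv p i j < pv k i' j' at hlt
  change x2 (pv k i' j') = (x (pv k i' j') + (if p < k then (if j < j' then ε * x (pv p i j') else 0)
    else 0) * x (pv k i' j)) + if i < i' ∧ (toLex (p, j) < toLex (k, j')) then
      ε * ((x (pv p i' j) + (if p < p then (if j < j then ε * x (pv p i j) else 0) else 0) *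
        x (pv p i' j)) * (x (pv k i j') +
          (if p < k then (if j < j' then ε * x (pv p i j') else 0) else 0) * x (pv k i j))) else 0
  rw [if_neg (lt_irrefl p)]
  rcases pv_lt_s12.1 hlt with hk | ⟨rfl, hk⟩
  · rw [hT.2 k i' j' hk]
    have : toLex (p, j) < toLex (k, j') := Prod.Lex.lt_iff.2 (Or.inl hk)
    simp only [this, and_true, if_pos hk]
    by_cases hi : i < i'
    · simp only [if_pos hi]; ring
    · simp only [if_neg hi]; ring
  · rw [hT.1 i' j' hlt]
    have : toLex (p, j) < toLex (p, j') ↔ j < j' := by simp [Prod.Lex.toLex_lt_toLex]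
    simp only [this, if_neg (lt_irrefl p), zero_mul, add_zero]

theorem stepC_B {p : Fin r} {i : Fin m} {j : Fin n} {ε Y : L} {x x2 : PageVar m n r → L}
    (hT : PTrans p i j ε x x2) (hs : ∀ z, z ∈ s ↔ pv p i j < z) (hyF : pv p i j ∈ F)
    (hF : NoChain rowB colB v F) (h : Cond rowB colB eB v F s x) (hε : ε * Y = 1)
    (hy : x2 (pv p i j) = Y) : Cond rowB colB eB v F (insert (pv p i j) s) x2 := by
  set γ : Lex (Fin r × Fin m) → L := fun c =>
    if p < (ofLex c).1 then (if i < (ofLex c).2 then ε * x (pv p (ofLex c).2 j) else 0) else 0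
    with hγ
  have h1 := Cond.colop viewB (x1 := fun z => x z + γ (colB z) *
      x (eB (rowB z) (toLex ((ofLex (colB z)).1, i)))) h γ (fun c => toLex ((ofLex c).1, i))
    (by
      intro c hc z hz
      rw [hs] at hz
      have hp : p < (ofLex c).1 := by
        by_contra hp
        exact hc (by simp only [hγ, if_neg hp])
      have hz' : (ofLex z).1 ≤ p := by
        by_contra hn
        exact hz (pv_lt_s12 (p' := (ofLex z).1) (i' := rowA z) (j' := rowB z).2
          (Or.inl (not_le.1 hn)))
      exact Prod.Lex.lt_iff.2 (Or.inl (hz'.trans_lt hp)))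
    (by intro i' c _; rfl)
  refine Cond.stepC viewB hs hyF hF h1 hε hy ?_
  intro j' c hlt
  obtain ⟨k, i'⟩ := c
  change pv p i j < pv k i' j' at hlt
  change x2 (pv k i' j') = (x (pv k i' j') + (if p < k then (if i < i' then ε * x (pv p i' j) else 0)
    else 0) * x (pv k i j')) + if j < j' ∧ (toLex (p, i) < toLex (k, i')) then
      ε * ((x (pv p i j') + (if p < p then (if i < i then ε * x (pv p i j) else 0) else 0) *
        x (pv p i j')) * (x (pv k i' j) +
          (if p < k then (if i < i' then ε * x (pv p i' j) else 0) else 0) * x (pv k i j))) else 0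
  rw [if_neg (lt_irrefl p)]
  rcases pv_lt_s12.1 hlt with hk | ⟨rfl, hk⟩
  · rw [hT.2 k i' j' hk]
    have : toLex (p, i) < toLex (k, i') := Prod.Lex.lt_iff.2 (Or.inl hk)
    simp only [this, and_true, if_pos hk]
    by_cases hi : j < j'
    · simp only [if_pos hi]; ring
    · simp only [if_neg hi]; ring
  · rw [hT.1 i' j' hlt]
    have : toLex (p, i) < toLex (p, i') ↔ i < i' := by simp [Prod.Lex.toLex_lt_toLex]
    simp only [this, if_neg (lt_irrefl p), zero_mul, add_zero]
    by_cases hi : i < i' <;> by_cases hj : j < j' <;> simp [hi, hj, mul_comm]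

theorem exists_trans {K : Type*} [Field K] [Algebra K L] {p : Fin r} {i : Fin m} {j : Fin n}
    {x : PageVar m n r → L} (hs : ∀ z, z ∈ s ↔ pv p i j < z) (hP : HProp (K := K) F s x) :
    ∃ x2 : PageVar m n r → RatFunc L, HProp (K := K) F (insert (pv p i j) s) x2 ∧
      x2 (pv p i j) = RatFunc.X⁻¹ ∧
      PTrans p i j RatFunc.X (fun z => algebraMap L (RatFunc L) (x z)) x2 := by
  classical
  set q : PageVar m n r → Polynomial L := fun z =>
    if pv p i j < z then
      if (ofLex z).1 = p then
        Polynomial.C (x z) + if i < rowA z ∧ j < rowB z then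
          Polynomial.X * (Polynomial.C (x (pv p (rowA z) j)) * Polynomial.C (x (pv p i (rowB z))))
          else 0
      else
        (Polynomial.C (x z) + (if j < rowB z then
          Polynomial.X * Polynomial.C (x (pv p i (rowB z))) else 0) *
            Polynomial.C (x (pv (ofLex z).1 (rowA z) j))) +
        (if i < rowA z then Polynomial.X * Polynomial.C (x (pv p (rowA z) j)) else 0) *
          (Polynomial.C (x (pv (ofLex z).1 i (rowB z))) + (if j < rowB z then
            Polynomial.X * Polynomial.C (x (pv p i (rowB z))) else 0) *
              Polynomial.C (x (pv (ofLex z).1 i j)))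
    else 1 with hq
  have hC : ∀ a : L, algebraMap (Polynomial L) (RatFunc L) (Polynomial.C a) =
      algebraMap L (RatFunc L) a := fun a => by
    rw [RatFunc.algebraMap_C, RatFunc.algebraMap_eq_C]
  refine ⟨fun z => if z = pv p i j then RatFunc.X⁻¹ else algebraMap _ _ (q z),
    hP.stepC hs _ (if_pos rfl) q (fun z hz => if_neg hz) (fun z hz => ?_) (fun z hz => ?_),
    if_pos rfl, fun i' j' hlt => ?_, fun k i' j' hk => ?_⟩
  · by_cases hlt : pv p i j < z
    · by_cases hzp : (ofLex z).1 = p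
      · simp only [hq, if_pos hlt, if_pos hzp]
        split_ifs <;> simp
      · simp only [hq, if_pos hlt, if_neg hzp]
        split_ifs <;> simp
    · simp only [hq, if_neg hlt, Polynomial.eval_one]
      exact (hP.1 z fun h => hlt ((hs z).1 h)).symm
  · have h1 : z ≠ pv p i j := fun h => hz (Or.inl h)
    have h2 : ¬ pv p i j < z := fun h => hz (Or.inr ((hs z).2 h))
    simp only [if_neg h1, hq, if_neg h2, map_one]
  · simp only
    rw [if_neg hlt.ne']
    have : q (pv p i' j') = Polynomial.C (x (pv p i' j')) + if i < i' ∧ j < j' then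
          Polynomial.X * (Polynomial.C (x (pv p i' j)) * Polynomial.C (x (pv p i j')))
          else 0 := by
      simp only [hq]
      rw [if_pos hlt, if_pos (show (ofLex (pv p i' j')).1 = p from rfl)]
      rfl
    rw [this]
    split_ifs <;> simp [hC]
  · have hlt : pv p i j < pv k i' j' := pv_lt_s12.2 (Or.inl hk)
    simp only
    rw [if_neg hlt.ne']
    have : q (pv k i' j') = (Polynomial.C (x (pv k i' j')) + (if j < j' then
          Polynomial.X * Polynomial.C (x (pv p i j')) else 0) *
            Polynomial.C (x (pv k i' j))) +
        (if i < i' then Polynomial.X * Polynomial.C (x (pv p i' j)) else 0) *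
          (Polynomial.C (x (pv k i j')) + (if j < j' then
            Polynomial.X * Polynomial.C (x (pv p i j')) else 0) *
              Polynomial.C (x (pv k i j))) := by
      simp only [hq]
      rw [if_pos hlt, if_neg (show ¬ ((ofLex (pv k i' j')).1 = p) from hk.ne')]
      rfl
    rw [this]
    split_ifs <;> simp only [map_add, map_mul, map_zero, RatFunc.algebraMap_X, hC]

/-- Sets of variables containing no leading monomial of a minor. -/
def Face (u v : ℕ) (F : Set (PageVar m n r)) : Prop :=
  NoChain rowA colA u F ∧ NoChain rowB colB v F

theorem exists_point {K : Type uK} [Field K] (hF : Maximal (Face u v) F)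
    (s : Finset (PageVar m n r)) : (∀ z ∈ s, ∀ z', z < z' → z' ∈ s) →
    ∃ (L : Type uK) (_ : Field L) (_ : Algebra K L) (x : PageVar m n r → L),
      HProp (K := K) F (s : Set _) x ∧ Cond rowA colA eA u F (s : Set _) x ∧
        Cond rowB colB eB v F (s : Set _) x := by
  classical
  induction s using Finset.induction_on_min with
  | empty =>
    intro _
    refine ⟨K, inferInstance, inferInstance, fun _ => 1, ⟨fun _ _ => rfl, ?_⟩, ?_, ?_⟩
    · intro f w hw h1 _ _
      have hf : f = monomial w (coeff w f) := by
        ext w'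
        rw [coeff_monomial]
        split_ifs with h
        · rw [h]
        · by_contra hne
          exact h (by ext z; exact (h1 w' (mem_support_iff.2 hne) z (by simp)).symm)
      rw [hf, aeval_monomial]
      simpa using hw
    · intro l t R C _ _ _ _ h5
      exact ⟨0, 0, fun a ha c hc => absurd (h5 a ha c hc) (by simp)⟩
    · intro l t R C _ _ _ _ h5
      exact ⟨0, 0, fun a ha c hc => absurd (h5 a ha c hc) (by simp)⟩
  | insert y s hmin ih =>
    intro hup
    obtain ⟨L, _, _, x, hP, hA, hB⟩ := ih fun z hz z' hzz' => by
      rcases Finset.mem_insert.1 (hup z (Finset.mem_insert_of_mem hz) z' hzz') with h | h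
      · rw [h] at hzz'
        exact absurd hzz' (not_lt.2 (hmin z hz).le)
      · exact h
    have hs : ∀ z, z ∈ (s : Set (PageVar m n r)) ↔ y < z := by
      intro z
      refine ⟨fun h => hmin z h, fun h => ?_⟩
      rcases Finset.mem_insert.1 (hup y (Finset.mem_insert_self _ _) z h) with h' | h'
      · rw [h'] at h
        exact absurd h (lt_irrefl _)
      · exact h'
    rw [Finset.coe_insert]
    obtain ⟨p, i, j⟩ : PageVar m n r := y
    set y : PageVar m n r := pv p i j with hy
    change ∃ (L : Type uK) (_ : Field L) (_ : Algebra K L) (x : PageVar m n r → L),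
      HProp (K := K) F (insert y (s : Set _)) x ∧ Cond rowA colA eA u F (insert y (s : Set _)) x ∧
        Cond rowB colB eB v F (insert y (s : Set _)) x
    change ∀ z, z ∈ (s : Set (PageVar m n r)) ↔ y < z at hs
    by_cases hyF : y ∈ F
    · obtain ⟨x2, hP2, hxy, hT⟩ := exists_trans hs hP
      have hε : (RatFunc.X : RatFunc L) * RatFunc.X⁻¹ = 1 := mul_inv_cancel₀ RatFunc.X_ne_zero
      exact ⟨RatFunc L, inferInstance, inferInstance, x2, hP2,
        stepC_A hT hs hyF hF.prop.1 (hA.map (algebraMap L (RatFunc L))) hε hxy,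
        stepC_B hT hs hyF hF.prop.2 (hB.map (algebraMap L (RatFunc L))) hε hxy⟩
    · have hn : ¬ Face u v (insert y F) := fun h =>
        hyF (hF.le_of_ge h (Set.subset_insert _ _) (Set.mem_insert _ _))
      have hm1 : ∀ {a : ℕ}, StrictMono fun i' : Fin a => (toLex (p, i') : Lex (Fin r × Fin a)) :=
        fun {a} a1 a2 h => Prod.Lex.lt_iff.2 (Or.inr ⟨rfl, h⟩)
      by_cases hn1 : NoChain rowA colA u (insert y F)
      · have hn2 : ¬ NoChain rowB colB v (insert y F) := fun h => hn ⟨hn1, h⟩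
        obtain ⟨x', h1, h2, h3⟩ := stepN_both viewB viewA hs (fun j' => toLex (p, j'))
          (fun i' => toLex (p, i')) (fun _ _ => rfl) hm1 hm1.monotone rfl rfl hB hA hP hyF
          hF.prop.2 hn2
        exact ⟨L, inferInstance, inferInstance, x', h1, h3, h2⟩
      · obtain ⟨x', h1, h2, h3⟩ := stepN_both viewA viewB hs (fun j' => toLex (p, j'))
          (fun i' => toLex (p, i')) (fun _ _ => rfl) hm1 hm1.monotone rfl rfl hA hB hP hyF
          hF.prop.1 hn1
        exact ⟨L, inferInstance, inferInstance, x', h1, h2, h3⟩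

end Concrete

section Final

theorem sum_single_le_one {σ : Type*} [LinearOrder σ] {t : ℕ} (g : Fin t → σ)
    (hg : Function.Injective g) (z : σ) : (∑ i, Finsupp.single (g i) 1 : σ →₀ ℕ) z ≤ 1 := by
  rw [sum_single_apply, Finset.sum_boole, Nat.cast_id, Finset.card_le_one]
  intro a ha b hb
  simp only [Finset.mem_filter, Finset.mem_univ, true_and] at ha hb
  exact hg (ha.trans hb.symm)

theorem sum_single_le {σ : Type*} [LinearOrder σ] {t : ℕ} (g : Fin t → σ)
    (hg : Function.Injective g) (w : σ →₀ ℕ) (hw : ∀ i, g i ∈ w.support) :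
    (∑ i, Finsupp.single (g i) 1 : σ →₀ ℕ) ≤ w := by
  intro z
  by_cases h : ∃ i, g i = z
  · obtain ⟨i, rfl⟩ := h
    exact (sum_single_le_one g hg _).trans (Nat.one_le_iff_ne_zero.2 (Finsupp.mem_support_iff.1 (hw i)))
  · rw [sum_single_apply, Finset.sum_eq_zero fun i _ => if_neg fun hi => h ⟨i, hi⟩]
    exact Nat.zero_le _

variable {K : Type*} [Field K] {m n r u v : ℕ}

theorem le_iff_lexLt (w' w : PageVar m n r →₀ ℕ) :
    (lexMO3 m n r).toSyn w' ≤ (lexMO3 m n r).toSyn w ↔ w' = w ∨ LexLt w' w := by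
  rw [le_iff_eq_or_lt]
  refine or_congr (EquivLike.injective _).eq_iff ?_
  have : (lexMO3 m n r).toSyn w' < (lexMO3 m n r).toSyn w ↔ toLex w' < toLex w := Iff.rfl
  rw [this, Finsupp.Lex.lt_iff]
  exact ⟨fun ⟨z, h1, h2⟩ => ⟨z, h2, h1⟩, fun ⟨z, h1, h2⟩ => ⟨z, h2, h1⟩⟩

theorem det_lead {t : ℕ} (M : Fin t → Fin t → PageVar m n r)
    (hr : ∀ i i' j, i < i' → M i j < M i' j) (hc : ∀ i j j', j < j' → M i j < M i j') :
    (lexMO3 m n r).degree (Matrix.of fun i j => (X (M i j) : MvPolynomial _ K)).det =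
      ∑ i, Finsupp.single (M i i) 1 ∧
    (lexMO3 m n r).leadingCoeff (Matrix.of fun i j => (X (M i j) : MvPolynomial _ K)).det = 1 := by
  have h1 : (lexMO3 m n r).degree (Matrix.of fun i j => (X (M i j) : MvPolynomial _ K)).det =
      ∑ i, Finsupp.single (M i i) 1 := by
    apply (lexMO3 m n r).toSyn.injective
    apply le_antisymm
    · rw [MonomialOrder.degree_le_iff]
      intro c h
      exact (le_iff_lexLt _ _).2 (det_support_lexLt M hr hc c h)
    · apply MonomialOrder.le_degree
      rw [mem_support_iff, det_coeff M hr hc]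
      exact one_ne_zero
  exact ⟨h1, by rw [MonomialOrder.leadingCoeff, h1, det_coeff M hr hc]⟩

/-- The generators. -/
def gens (m n r u v : ℕ) (K : Type*) [Field K] : Set (MvPolynomial (PageVar m n r) K) :=
  {f : MvPolynomial (PageVar m n r) K |
        ∃ (a : Fin u → Fin m) (b : Fin u → Lex (Fin r × Fin n)),
          StrictMono a ∧ StrictMono b ∧ f = ((horizCat m n r K).submatrix a b).det} ∪
     {f : MvPolynomial (PageVar m n r) K |
        ∃ (a : Fin v → Lex (Fin r × Fin m)) (b : Fin v → Fin n),
          StrictMono a ∧ StrictMono b ∧ f = ((vertCat m n r K).submatrix a b).det}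

theorem leadA (a : Fin u → Fin m) (b : Fin u → Lex (Fin r × Fin n)) (ha : StrictMono a)
    (hb : StrictMono b) :
    (lexMO3 m n r).degree ((horizCat m n r K).submatrix a b).det =
      ∑ i, Finsupp.single (eA (a i) (b i)) 1 ∧
    (lexMO3 m n r).leadingCoeff ((horizCat m n r K).submatrix a b).det = 1 :=
  det_lead (fun i j => eA (a i) (b j)) (fun _ _ _ h => viewA.mono_r _ _ _ (ha h))
    (fun _ _ _ h => viewA.mono_c _ _ _ (hb h))

theorem leadB (a : Fin v → Lex (Fin r × Fin m)) (b : Fin v → Fin n) (ha : StrictMono a)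
    (hb : StrictMono b) :
    (lexMO3 m n r).degree ((vertCat m n r K).submatrix a b).det =
      ∑ i, Finsupp.single (eB (b i) (a i)) 1 ∧
    (lexMO3 m n r).leadingCoeff ((vertCat m n r K).submatrix a b).det = 1 :=
  det_lead (fun i j => eB (b j) (a i)) (fun _ _ _ h => viewB.mono_c _ _ _ (ha h))
    (fun _ _ _ h => viewB.mono_r _ _ _ (hb h))

theorem gens_lead {g : MvPolynomial (PageVar m n r) K} (hg : g ∈ gens m n r u v K) :
    (lexMO3 m n r).leadingCoeff g = 1 := by
  rcases hg with ⟨a, b, ha, hb, rfl⟩ | ⟨a, b, ha, hb, rfl⟩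
  · exact (leadA a b ha hb).2
  · exact (leadB a b ha hb).2

theorem exists_gen (w : PageVar m n r →₀ ℕ) (hw : ¬ Face u v (w.support : Set (PageVar m n r))) :
    ∃ g ∈ gens m n r u v K, (lexMO3 m n r).degree g ≤ w ∧
      ∀ z, (lexMO3 m n r).degree g z ≤ 1 := by
  by_cases hA : NoChain rowA colA u (w.support : Set (PageVar m n r))
  · have hB : ¬ NoChain rowB colB v (w.support : Set (PageVar m n r)) := fun h => hw ⟨hA, h⟩
    unfold NoChain at hB
    push Not at hB
    obtain ⟨l, hl, hlw, rfl⟩ := hB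
    have hget := List.pairwise_iff_get.1 hl
    have ha : StrictMono fun i => colB (l.get i) := fun i j h => (hget i j h).2
    have hb : StrictMono fun i => rowB (l.get i) := fun i j h => (hget i j h).1
    have hinj : Function.Injective l.get := fun i j h => hb.injective (congrArg rowB h)
    refine ⟨_, Or.inr ⟨_, _, ha, hb, rfl⟩, ?_⟩
    rw [(leadB _ _ ha hb).1]
    simp only [viewB.e_rc]
    exact ⟨sum_single_le _ hinj w fun i => hlw _ (List.get_mem _ _), sum_single_le_one _ hinj⟩
  · unfold NoChain at hA
    push Not at hA
    obtain ⟨l, hl, hlw, rfl⟩ := hA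
    have hget := List.pairwise_iff_get.1 hl
    have ha : StrictMono fun i => colA (l.get i) := fun i j h => (hget i j h).2
    have hb : StrictMono fun i => rowA (l.get i) := fun i j h => (hget i j h).1
    have hinj : Function.Injective l.get := fun i j h => hb.injective (congrArg rowA h)
    refine ⟨_, Or.inl ⟨_, _, hb, ha, rfl⟩, ?_⟩
    rw [(leadA _ _ hb ha).1]
    simp only [viewA.e_rc]
    exact ⟨sum_single_le _ hinj w fun i => hlw _ (List.get_mem _ _), sum_single_le_one _ hinj⟩

theorem not_face (hu : 1 ≤ u) (hv : 1 ≤ v) {f : MvPolynomial (PageVar m n r) K}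
    (hf : f ∈ (doubleDetIdeal m n r u v K).radical) (hf0 : f ≠ 0) :
    ¬ Face u v (((lexMO3 m n r).degree f).support : Set (PageVar m n r)) := by
  classical
  intro hface
  obtain ⟨F, hFle, hF⟩ := Finite.exists_le_maximal hface
  have := Fintype.ofFinite (PageVar m n r)
  obtain ⟨L, _, _, x, hP, hA, hB⟩ := exists_point (K := K) hF Finset.univ
    (fun _ _ _ _ => Finset.mem_univ _)
  rw [Finset.coe_univ] at hP hA hB
  have hI : doubleDetIdeal m n r u v K ≤ RingHom.ker (aeval x : MvPolynomial _ K →ₐ[K] L) := by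
    rw [doubleDetIdeal, Ideal.span_le]
    rintro g (⟨a, b, -, -, rfl⟩ | ⟨a, b, -, -, rfl⟩)
    · rw [SetLike.mem_coe, RingHom.mem_ker, AlgHom.map_det, ← hA.det_eq_zero hu a b]
      congr 1
      ext i j
      simp [horizCat, eA, pv]
    · rw [SetLike.mem_coe, RingHom.mem_ker, AlgHom.map_det, ← hB.swap.det_eq_zero hv a b]
      congr 1
      ext i j
      simp [vertCat, eB, pv]
  obtain ⟨k, hk⟩ := hf
  have h0 := hI hk
  rw [RingHom.mem_ker, map_pow] at h0
  refine hP.2 f _ ((lexMO3 m n r).degree_mem_support hf0) (fun _ _ z hz => absurd trivial hz)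
    (fun z _ hz => ?_) (fun w' hw' => (le_iff_lexLt _ _).1 ((lexMO3 m n r).le_degree hw'))
    (eq_zero_of_pow_eq_zero h0)
  by_contra hne
  exact hz (hFle (Finsupp.mem_support_iff.2 hne))

end Final

/-- The initial ideal of the double determinantal ideal w.r.t. the consistent lexicographic
order is generated by squarefree monomials, and consequently the ideal is radical. -/
theorem stmt_12 {K : Type*} [Field K] (m n r u v : ℕ) (hu1 : 1 ≤ u) (hv1 : 1 ≤ v)
    (hum : u ≤ m) (hunr : u ≤ n * r) (hvn : v ≤ n) (hvmr : v ≤ m * r) :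
    (∃ E : Set (PageVar m n r →₀ ℕ),
      (∀ e ∈ E, ∀ x, e x ≤ 1) ∧
      Ideal.span {g : MvPolynomial (PageVar m n r) K |
          ∃ f ∈ doubleDetIdeal m n r u v K, f ≠ 0 ∧
            g = monomial (mdeg (lexMO3 m n r) f) (1 : K)} =
        Ideal.span ((fun e => (monomial e (1 : K) : MvPolynomial (PageVar m n r) K)) '' E)) ∧
    (doubleDetIdeal m n r u v K).IsRadical := by
  have hgen : ∀ g ∈ gens m n r u v K, g ∈ doubleDetIdeal m n r u v K :=
    fun g hg => Ideal.subset_span hg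
  constructor
  · refine ⟨{e | (∀ x, e x ≤ 1) ∧ ∃ f ∈ doubleDetIdeal m n r u v K, f ≠ 0 ∧
      e = mdeg (lexMO3 m n r) f}, fun e he => he.1, le_antisymm ?_ ?_⟩
    · rw [Ideal.span_le]
      rintro _ ⟨f, hf, hf0, rfl⟩
      obtain ⟨g, hg, hle, hsq⟩ := exists_gen (K := K) _
        (not_face hu1 hv1 (Ideal.le_radical hf) hf0)
      have hg0 : g ≠ 0 := by
        rintro rfl
        have := gens_lead hg
        simp at this
      have h1 : (monomial (mdeg (lexMO3 m n r) f) (1 : K) : MvPolynomial (PageVar m n r) K) =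
          monomial ((lexMO3 m n r).degree f - (lexMO3 m n r).degree g) 1 *
            monomial ((lexMO3 m n r).degree g) 1 := by
        rw [monomial_mul, tsub_add_cancel_of_le hle, one_mul]
        rfl
      rw [SetLike.mem_coe, h1]
      exact Ideal.mul_mem_left _ _ (Ideal.subset_span ⟨_, ⟨hsq, g, hgen g hg, hg0, rfl⟩, rfl⟩)
    · apply Ideal.span_mono
      rintro _ ⟨e, ⟨-, f, hf, hf0, rfl⟩, rfl⟩
      exact ⟨f, hf, hf0, rfl⟩
  · intro f hf
    obtain ⟨c, q, hfq, -, hq⟩ := (lexMO3 m n r).div_set (B := gens m n r u v K)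
      (fun b hb => by rw [gens_lead hb]; exact isUnit_one) f
    have hc : Finsupp.linearCombination _
        (fun b : gens m n r u v K => (b : MvPolynomial (PageVar m n r) K)) c ∈
        doubleDetIdeal m n r u v K := by
      rw [Finsupp.linearCombination_apply, Finsupp.sum]
      exact Ideal.sum_mem _ fun b _ => Ideal.mul_mem_left _ _ (hgen b b.2)
    have hq0 : q = 0 := by
      by_contra hq0
      have hqr : q ∈ (doubleDetIdeal m n r u v K).radical := by
        have : q = f - Finsupp.linearCombination _
            (fun b : gens m n r u v K => (b : MvPolynomial (PageVar m n r) K)) c := by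
          rw [hfq]; ring
        rw [this]
        exact Ideal.sub_mem _ hf (Ideal.le_radical hc)
      obtain ⟨g, hg, hle, -⟩ := exists_gen (K := K) _ (not_face hu1 hv1 hqr hq0)
      exact hq _ ((lexMO3 m n r).degree_mem_support hq0) g hg hle
    rw [hfq, hq0, add_zero]
    exact hc
end

section
/- Triple determinantal ideal equality: Let X be a 3-dimensional m×n×r array of indeterminates over an algebraically closed field K, and let 2 ≤ u ≤ min(m,nr), 2 ≤ v ≤ min(n,mr), 2 ≤ w ≤ min(r,mn). Let I_{u,v} be the ideal generated by the u-minors of a first flattening and the v-minors of a second flattening, and let I_{u,v,w} = I_{u,v} + (ideal generated by w-minors of a third flattening). Then I_{u,v} = I_{u,v,w} if and only if (u−1)(v−1) ≤ w−1. -/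
open MvPolynomial

/-- The set of `u`-minors of a matrix: determinants of `u × u` submatrices obtained by
choosing `u` distinct rows and `u` distinct columns. -/
def minorsOf {R : Type*} [CommRing R] {a b : Type*} (M : Matrix a b R) (u : ℕ) : Set R :=
  {f | ∃ (p : Fin u → a) (q : Fin u → b),
    Function.Injective p ∧ Function.Injective q ∧ f = (M.submatrix p q).det}

/-- The first flattening of the generic `m×n×r` tensor of indeterminates. -/
noncomputable def genFlat1 (m n r : ℕ) (K : Type*) [Field K] :
    Matrix (Fin m) (Fin n × Fin r) (MvPolynomial (Fin m × Fin n × Fin r) K) :=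
  Matrix.of fun i p => X (i, p.1, p.2)

/-- The second flattening of the generic `m×n×r` tensor of indeterminates. -/
noncomputable def genFlat2 (m n r : ℕ) (K : Type*) [Field K] :
    Matrix (Fin n) (Fin m × Fin r) (MvPolynomial (Fin m × Fin n × Fin r) K) :=
  Matrix.of fun j p => X (p.1, j, p.2)

/-- The third flattening of the generic `m×n×r` tensor of indeterminates. -/
noncomputable def genFlat3 (m n r : ℕ) (K : Type*) [Field K] :
    Matrix (Fin r) (Fin m × Fin n) (MvPolynomial (Fin m × Fin n × Fin r) K) :=
  Matrix.of fun k p => X (p.1, p.2, k)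

namespace TripleDet

open Equiv

/-- Sums of signed terms invariant under right multiplication by a transposition vanish. -/
lemma signed_sum_zero {α M : Type*} [Fintype α] [DecidableEq α] [AddCommGroup M]
    (F : Perm α → M) (x y : α) (hxy : x ≠ y) (hF : ∀ ρ, F (ρ * swap x y) = F ρ) :
    ∑ ρ : Perm α, ((Perm.sign ρ : ℤˣ) : ℤ) • F ρ = 0 := by
  refine Finset.sum_involution (fun ρ _ => ρ * swap x y) ?_ ?_ ?_ ?_
  · intro ρ _
    simp [hF, Perm.sign_mul, Perm.sign_swap hxy]
  · intro ρ _ _ h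
    have : swap x y = 1 := by simpa using h
    exact hxy (swap_eq_one_iff.mp this)
  · intro ρ _; exact Finset.mem_univ _
  · intro ρ _; simp [mul_assoc]

/-- The first moved point of a nontrivial permutation moves up. -/
lemma exists_first_moved {w : ℕ} (ρ : Perm (Fin w)) (h : ρ ≠ 1) :
    ∃ t, (∀ s < t, ρ s = s) ∧ t < ρ t := by
  have hne : ∃ t, ρ t ≠ t := by
    by_contra hcon
    push Not at hcon
    exact h (Equiv.ext hcon)
  obtain ⟨t, ht, hmin⟩ := WellFounded.has_min (wellFounded_lt (α := Fin w)) {t | ρ t ≠ t} hne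
  have hfix : ∀ s < t, ρ s = s := by
    intro s hs
    by_contra hc
    exact hmin s hc hs
  refine ⟨t, hfix, ?_⟩
  rcases lt_trichotomy t (ρ t) with h1 | h1 | h1
  · exact h1
  · exact absurd h1.symm ht
  · exact absurd (ρ.injective (hfix _ h1)) ht

/-- Antisymmetrization over any `u` positions vanishes. -/
def Rel (w u : ℕ) (M : Type*) [AddCommGroup M] : AddSubgroup (Perm (Fin w) → M) where
  carrier := {G | ∀ (e : Fin u ↪ Fin w) (σ : Perm (Fin w)),
    ∑ ρ : Perm (Fin u), ((Perm.sign ρ : ℤˣ) : ℤ) • G (σ * ρ.viaEmbedding e) = 0}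
  zero_mem' := by intro e σ; simp
  add_mem' := by
    intro a b ha hb e σ
    simp only [Pi.add_apply, smul_add, Finset.sum_add_distrib]
    rw [ha e σ, hb e σ, add_zero]
  neg_mem' := by
    intro a ha e σ
    simp only [Pi.neg_apply, smul_neg, Finset.sum_neg_distrib]
    rw [ha e σ, neg_zero]

/-- No decreasing subsequence of length `u`. -/
def Good {w : ℕ} (u : ℕ) (π : Perm (Fin w)) : Prop :=
  ∀ S : Finset (Fin w), StrictAntiOn π S → S.card < u

/-- Key for the lexicographic order. -/
def key {w : ℕ} (π : Perm (Fin w)) : Lex (Fin w → Fin w) := toLex (fun i => π i)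

lemma key_inj {w : ℕ} : Function.Injective (key (w := w)) := by
  intro a b h
  ext i
  have := congrFun (toLex.injective h) i
  exact congrArg Fin.val this

lemma straighten {w u : ℕ} {M : Type*} [AddCommGroup M] (G : Perm (Fin w) → M)
    (hG : G ∈ Rel w u M) (h0 : ∀ π, Good u π → G π = 0) : ∀ σ, G σ = 0 := by
  intro σ
  induction hk : key σ using WellFoundedLT.induction generalizing σ with
  | ind k ih =>
    subst hk
    by_cases hg : Good u σ
    · exact h0 σ hg
    unfold Good at hg
    push Not at hg
    obtain ⟨S, hS, hcard⟩ := hg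
    obtain ⟨S', hS'S, hS'⟩ := Finset.exists_subset_card_eq hcard
    let e : Fin u ↪ Fin w := (S'.orderEmbOfFin hS').toEmbedding
    have he : ∀ i, e i ∈ S := fun i => hS'S (Finset.orderEmbOfFin_mem S' hS' i)
    have hrel := hG e σ
    rw [← Finset.add_sum_erase _ _ (Finset.mem_univ (1 : Perm (Fin u))),
      Finset.sum_eq_zero] at hrel
    · have h1 : (1 : Perm (Fin u)).viaEmbedding e = 1 :=
        map_one (Perm.viaEmbeddingHom e)
      simpa [h1] using hrel
    · intro ρ hρ
      have hρ1 : ρ ≠ 1 := (Finset.mem_erase.mp hρ).1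
      have hρ2 : ρ.viaEmbedding e ≠ 1 := by
        intro hc
        apply hρ1
        exact Perm.viaEmbeddingHom_injective e (hc.trans (map_one (Perm.viaEmbeddingHom e)).symm)
      obtain ⟨t, ht, htt⟩ := exists_first_moved _ hρ2
      have hlt : key (σ * ρ.viaEmbedding e) < key σ := by
        refine ⟨t, fun s hs => ?_, ?_⟩
        · simp [key, ht s hs]
        · by_cases hr : t ∈ Set.range e
          · obtain ⟨s, rfl⟩ := hr
            rw [Perm.viaEmbedding_apply] at htt
            change σ ((ρ.viaEmbedding e) (e s)) < σ (e s)
            rw [Perm.viaEmbedding_apply]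
            exact hS (he _) (he _) htt
          · rw [Perm.viaEmbedding_apply_of_notMem _ _ _ hr] at htt
            exact absurd htt (lt_irrefl _)
      rw [ih _ hlt _ rfl, smul_zero]

open Classical in
/-- Length of the longest decreasing subsequence ending at `i`. -/
noncomputable def col {w : ℕ} (π : Perm (Fin w)) (i : Fin w) : ℕ :=
  (Finset.univ.filter (fun S : Finset (Fin w) =>
    StrictAntiOn π S ∧ i ∈ S ∧ ∀ j ∈ S, j ≤ i)).sup Finset.card

lemma col_pos {w : ℕ} (π : Perm (Fin w)) (i : Fin w) : 0 < col π i := by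
  classical
  have : ({i} : Finset (Fin w)).card ≤ col π i := by
    unfold col
    apply Finset.le_sup (f := Finset.card)
    simp
  rw [Finset.card_singleton] at this
  exact this

lemma col_lt {w u : ℕ} (π : Perm (Fin w)) (hπ : Good u π) (i : Fin w) : col π i < u := by
  classical
  have hu : 0 < u := by
    have := hπ ∅ (by intro a ha; simp at ha)
    simpa using this
  unfold col
  rw [Finset.sup_lt_iff (by simpa using hu)]
  intro S hS
  exact hπ S (Finset.mem_filter.mp hS).2.1

lemma col_mono {w : ℕ} (π : Perm (Fin w)) {i j : Fin w} (hij : i < j)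
    (h : col π i = col π j) : π i < π j := by
  classical
  by_contra hc
  have hc' : π j < π i := lt_of_le_of_ne (not_lt.mp hc) (fun h => hij.ne' (π.injective h))
  have hex : ∃ S ∈ (Finset.univ.filter (fun S : Finset (Fin w) =>
      StrictAntiOn π S ∧ i ∈ S ∧ ∀ j ∈ S, j ≤ i)), col π i = S.card := by
    unfold col
    convert Finset.exists_mem_eq_sup _ _ _
    exact ⟨{i}, by simp⟩
  obtain ⟨S, hS, hcard⟩ := hex
  obtain ⟨-, hanti, hiS, hle⟩ := Finset.mem_filter.mp hS
  have hjS : j ∉ S := fun hj => absurd (hle j hj) (not_le.mpr hij)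
  have hle' : ∀ a ∈ S, π j < π a := by
    intro a ha
    rcases (hle a ha).lt_or_eq with h1 | h1
    · exact hc'.trans (hanti ha hiS h1)
    · rw [h1]; exact hc'
  have : (insert j S).card ≤ col π j := by
    unfold col
    apply Finset.le_sup (f := Finset.card)
    refine Finset.mem_filter.mpr ⟨Finset.mem_univ _, ?_, Finset.mem_insert_self _ _, ?_⟩
    · intro a ha b hb hab
      simp only [Finset.coe_insert, Set.mem_insert_iff, Finset.mem_coe] at ha hb
      rcases ha with rfl | ha
      · rcases hb with rfl | hb
        · exact absurd hab (lt_irrefl _)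
        · exact absurd (hab.trans_le (hle b hb)) (not_lt.mpr hij.le)
      · rcases hb with rfl | hb
        · exact hle' a ha
        · exact hanti ha hb hab
    · intro a ha
      rcases Finset.mem_insert.mp ha with rfl | ha
      · exact le_rfl
      · exact (hle a ha).trans hij.le
  rw [Finset.card_insert_of_notMem hjS] at this
  omega

open Classical in
/-- Matrix-entry functional attached to a good permutation. -/
noncomputable def phi {w : ℕ} (u : ℕ) (π σ : Perm (Fin w)) : ℤ :=
  if Good u π ∧ ∀ i, col π (π⁻¹ (σ i)) = col π i then 1 else 0

lemma phi_swap {w u : ℕ} (π σ : Perm (Fin w)) (x y : Fin w) (h : col π x = col π y) :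
    phi u π (σ * swap x y) = phi u π σ := by
  have hs : ∀ i, col π (swap x y i) = col π i := by
    intro i
    by_cases hx : i = x
    · subst hx; simp [h]
    by_cases hy : i = y
    · subst hy; simp [h]
    rw [swap_apply_of_ne_of_ne hx hy]
  unfold phi
  congr 1
  apply propext
  refine and_congr_right fun _ => ⟨fun H i => ?_, fun H i => ?_⟩
  · have := H (swap x y i)
    simpa [hs] using this
  · have := H (swap x y i)
    simpa [hs] using this

lemma phi_self {w u : ℕ} (π : Perm (Fin w)) (h : Good u π) : phi u π π = 1 := by
  simp [phi, h]

lemma phi_key {w u : ℕ} (π σ : Perm (Fin w)) (h : phi u π σ ≠ 0) : key π ≤ key σ := by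
  have h' : ∀ i, col π (π⁻¹ (σ i)) = col π i := by
    by_contra hc
    apply h
    unfold phi
    rw [if_neg (fun h => hc h.2)]
  by_cases h1 : π⁻¹ * σ = 1
  · have : π = σ := by rwa [inv_mul_eq_one] at h1
    rw [this]
  · obtain ⟨t, ht, htt⟩ := exists_first_moved _ h1
    apply le_of_lt
    refine ⟨t, fun s hs => ?_, ?_⟩
    · have := ht s hs
      simp only [Perm.mul_apply] at this
      rw [Perm.inv_eq_iff_eq] at this
      simp [key, this]
    · have := col_mono π htt (by simpa using (h' t).symm)
      simpa [key] using this

lemma exists_col_eq {w u k : ℕ} (π : Perm (Fin w)) (h : Good u π) (hk : u ≤ k)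
    (e : Fin k → Fin w) (hu : 0 < u) : ∃ s s', s ≠ s' ∧ col π (e s) = col π (e s') := by
  obtain ⟨s, -, s', -, hne, heq⟩ := Finset.exists_ne_map_eq_of_card_lt_of_maps_to
    (s := (Finset.univ : Finset (Fin k))) (t := Finset.Ico 1 u)
    (f := fun s => col π (e s)) (by simp; omega)
    (by
      intro s _
      simp only [Finset.coe_Ico, Set.mem_Ico]
      exact ⟨col_pos π _, col_lt π h _⟩)
  exact ⟨s, s', hne, heq⟩

lemma viaEmbedding_mul_swap {w u : ℕ} (e : Fin u ↪ Fin w) (ρ : Perm (Fin u)) (s s' : Fin u) :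
    (ρ * swap s s').viaEmbedding e = ρ.viaEmbedding e * swap (e s) (e s') := by
  ext1 i
  by_cases hr : i ∈ Set.range e
  · obtain ⟨t, rfl⟩ := hr
    rw [Perm.mul_apply, ← e.injective.map_swap, Perm.viaEmbedding_apply, Perm.viaEmbedding_apply]
    rfl
  · rw [Perm.viaEmbedding_apply_of_notMem _ _ _ hr, Perm.mul_apply, swap_apply_of_ne_of_ne,
      Perm.viaEmbedding_apply_of_notMem _ _ _ hr]
    · rintro rfl; exact hr ⟨_, rfl⟩
    · rintro rfl; exact hr ⟨_, rfl⟩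

lemma phi_rel {w u : ℕ} {M : Type*} [AddCommGroup M] (hu : 0 < u) (π : Perm (Fin w)) (m : M) :
    (fun σ => phi u π σ • m) ∈ Rel w u M := by
  intro e σ
  by_cases hg : Good u π
  · obtain ⟨s, s', hne, heq⟩ := exists_col_eq π hg le_rfl e hu
    apply signed_sum_zero _ s s' hne
    intro ρ
    simp only
    rw [viaEmbedding_mul_swap, ← mul_assoc, phi_swap _ _ _ _ heq]
  · simp [phi, hg]

lemma expand {w u : ℕ} {M : Type*} [AddCommGroup M] (hu : 0 < u) (G : Perm (Fin w) → M)
    (hG : G ∈ Rel w u M) : ∃ h : Perm (Fin w) → M, ∀ σ, G σ = ∑ π, phi u π σ • h π := by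
  classical
  induction hk : (Finset.univ.filter (fun σ : Perm (Fin w) =>
    ∃ π, Good u π ∧ key π ≤ key σ ∧ G π ≠ 0)).card using Nat.strong_induction_on
    generalizing G with
  | _ k ih =>
    by_cases h0 : ∀ π, Good u π → G π = 0
    · exact ⟨0, fun σ => by simp [straighten G hG h0 σ]⟩
    push Not at h0
    obtain ⟨π, ⟨hπg, hπ0⟩, hmin⟩ := WellFounded.has_min
      (InvImage.wf (key (w := w)) wellFounded_lt) {π | Good u π ∧ G π ≠ 0} h0
    have hmin' : ∀ π', Good u π' → G π' ≠ 0 → key π ≤ key π' := fun π' h1 h2 =>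
      not_lt.mp (hmin π' ⟨h1, h2⟩)
    let G' : Perm (Fin w) → M := G - fun σ => phi u π σ • G π
    have hG' : G' ∈ Rel w u M := sub_mem hG (phi_rel hu π _)
    have key1 : ∀ π', Good u π' → G' π' ≠ 0 → key π < key π' := by
      intro π' hg' hne
      have hle : key π ≤ key π' := by
        by_cases hG0 : G π' = 0
        · apply phi_key (u := u)
          intro hc
          apply hne
          simp [G', hG0, hc]
        · exact hmin' _ hg' hG0
      refine lt_of_le_of_ne hle ?_
      intro heq
      have := key_inj heq
      subst this
      apply hne
      simp [G', phi_self π hπg]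
    obtain ⟨h, hh⟩ := ih _ (by
      rw [← hk]
      apply Finset.card_lt_card
      refine Finset.ssubset_iff_of_subset ?_ |>.mpr ⟨π, ?_, ?_⟩
      · intro σ hσ
        obtain ⟨π', hg', hle, hne⟩ := (Finset.mem_filter.mp hσ).2
        exact Finset.mem_filter.mpr ⟨Finset.mem_univ _, π, hπg,
          (key1 π' hg' hne).le.trans hle, hπ0⟩
      · exact Finset.mem_filter.mpr ⟨Finset.mem_univ _, π, hπg, le_rfl, hπ0⟩
      · intro hσ
        obtain ⟨π', hg', hle, hne⟩ := (Finset.mem_filter.mp hσ).2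
        exact absurd (key1 π' hg' hne) (not_lt.mpr hle)) G' hG' rfl
    refine ⟨h + Pi.single π (G π), fun σ => ?_⟩
    have h1 : G σ = G' σ + phi u π σ • G π := by simp [G']
    rw [h1, hh σ]
    simp only [Pi.add_apply, smul_add, Finset.sum_add_distrib]
    congr 1
    rw [Finset.sum_eq_single π]
    · simp
    · intro b _ hb
      simp [Pi.single_eq_of_ne hb]
    · simp

/-- The key vanishing statement. -/
lemma antisymm_zero {w u v : ℕ} {M : Type*} [AddCommGroup M] (hu : 0 < u) (hv : 0 < v)
    (hw : (u - 1) * (v - 1) < w)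
    (T : Perm (Fin w) → Perm (Fin w) → M)
    (h1 : ∀ τ, (fun σ => T σ τ) ∈ Rel w u M) (h2 : ∀ σ, T σ ∈ Rel w v M) :
    ∑ σ : Perm (Fin w), ((Perm.sign σ : ℤˣ) : ℤ) • T σ σ = 0 := by
  let G : Perm (Fin w) → Rel w v M := fun σ => ⟨T σ, h2 σ⟩
  have hG : G ∈ Rel w u (Rel w v M) := by
    intro e σ
    apply Subtype.ext
    funext τ
    have := h1 τ e σ
    simpa [G, Finset.sum_apply] using this
  obtain ⟨h, hh⟩ := expand hu G hG
  choose k hk using fun π => expand hv (h π).1 (h π).2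
  have hT : ∀ σ, T σ σ = ∑ π, ∑ ρ, (phi u π σ * phi v ρ σ) • k π ρ := by
    intro σ
    have := congrFun (congrArg Subtype.val (hh σ)) σ
    simp only [G, AddSubgroup.val_finsetSum, Finset.sum_apply, AddSubgroupClass.coe_zsmul,
      Pi.smul_apply] at this
    rw [this]
    refine Finset.sum_congr rfl fun π _ => ?_
    rw [hk, Finset.smul_sum]
    simp only [mul_smul]
  simp only [hT, Finset.smul_sum]
  rw [Finset.sum_comm]
  refine Finset.sum_eq_zero fun π _ => ?_
  rw [Finset.sum_comm]
  refine Finset.sum_eq_zero fun ρ _ => ?_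
  by_cases hg : Good u π ∧ Good v ρ
  · obtain ⟨s, -, s', -, hne, heq⟩ := Finset.exists_ne_map_eq_of_card_lt_of_maps_to
      (s := (Finset.univ : Finset (Fin w))) (t := Finset.Ico 1 u ×ˢ Finset.Ico 1 v)
      (f := fun s => (col π s, col ρ s)) (by simpa using hw)
      (by
        intro s _
        simp only [Finset.coe_product, Finset.coe_Ico, Set.mem_prod, Set.mem_Ico]
        exact ⟨⟨col_pos π _, col_lt π hg.1 _⟩, ⟨col_pos ρ _, col_lt ρ hg.2 _⟩⟩)
    simp only [Prod.mk.injEq] at heq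
    apply signed_sum_zero _ s s' hne
    intro σ
    rw [phi_swap _ _ _ _ heq.1, phi_swap _ _ _ _ heq.2]
  · refine Finset.sum_eq_zero fun σ _ => ?_
    have : phi u π σ * phi v ρ σ = 0 := by
      rcases not_and_or.mp hg with h | h <;> simp [phi, h]
    rw [this, zero_smul, smul_zero]

/-- Minor expansion: product with antisymmetrized rows lies in a given ideal. -/
lemma prod_rel {R α β : Type*} [CommRing R] {w u : ℕ} (I : Ideal R) (Mx : Matrix α β R)
    (hI : ∀ f ∈ minorsOf Mx u, f ∈ I) (a : Fin w → α) (q : Fin w → β)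
    (hq : Function.Injective q) :
    (fun σ : Perm (Fin w) => Ideal.Quotient.mk I (∏ t, Mx (a (σ t)) (q t))) ∈
      Rel w u (R ⧸ I) := by
  classical
  intro e σ
  have hdet : (Mx.submatrix (fun i => a (σ (e i))) (fun i => q (e i))).det ∈ I := by
    by_cases hp : Function.Injective (fun i => a (σ (e i)))
    · exact hI _ ⟨_, _, hp, hq.comp e.injective, rfl⟩
    · unfold Function.Injective at hp
      push Not at hp
      obtain ⟨i, j, hij, hne⟩ := hp
      rw [Matrix.det_zero_of_row_eq hne]
      · exact I.zero_mem
      · funext k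
        simp only [Matrix.submatrix_apply, hij]
  have hsum : ∑ ρ : Perm (Fin u), ((Perm.sign ρ : ℤˣ) : ℤ) •
      (∏ t, Mx (a ((σ * ρ.viaEmbedding e) t)) (q t)) =
      (Mx.submatrix (fun i => a (σ (e i))) (fun i => q (e i))).det *
        ∏ t ∈ Finset.univ \ Finset.univ.map e, Mx (a (σ t)) (q t) := by
    rw [Matrix.det_apply, Finset.sum_mul]
    refine Finset.sum_congr rfl fun ρ _ => ?_
    rw [← Finset.prod_sdiff (Finset.subset_univ (Finset.univ.map e)), Finset.prod_map, mul_comm]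
    rw [Units.smul_def, smul_mul_assoc]
    congr 2
    · refine Finset.prod_congr rfl fun t _ => ?_
      simp [Perm.viaEmbedding_apply]
    · refine Finset.prod_congr rfl fun t ht => ?_
      have : t ∉ Set.range e := by
        intro hr
        simp at ht hr
        obtain ⟨y, hy⟩ := hr
        exact ht y hy
      rw [Perm.mul_apply, Perm.viaEmbedding_apply_of_notMem _ _ _ this]
  have : Ideal.Quotient.mk I (∑ ρ : Perm (Fin u), ((Perm.sign ρ : ℤˣ) : ℤ) •
      (∏ t, Mx (a ((σ * ρ.viaEmbedding e) t)) (q t))) = 0 := by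
    rw [hsum, Ideal.Quotient.eq_zero_iff_mem]
    exact I.mul_mem_right _ hdet
  simpa only [map_sum, map_zsmul] using this

lemma minor3_mem {K : Type*} [Field K] {m n r u v w : ℕ} (hu : 0 < u) (hv : 0 < v)
    (hw : (u - 1) * (v - 1) < w) (f : MvPolynomial (Fin m × Fin n × Fin r) K)
    (hf : f ∈ minorsOf (genFlat3 m n r K) w) :
    f ∈ Ideal.span (minorsOf (genFlat1 m n r K) u ∪ minorsOf (genFlat2 m n r K) v) := by
  obtain ⟨k, q, hk, hq, rfl⟩ := hf
  set I := Ideal.span (minorsOf (genFlat1 m n r K) u ∪ minorsOf (genFlat2 m n r K) v) with hI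
  let T : Perm (Fin w) → Perm (Fin w) → (MvPolynomial (Fin m × Fin n × Fin r) K ⧸ I) :=
    fun σ τ => Ideal.Quotient.mk I (∏ t, X ((q (σ t)).1, (q (τ t)).2, k t))
  have := antisymm_zero hu hv hw T
    (fun τ => prod_rel I (genFlat1 m n r K)
      (fun f hf => Ideal.subset_span (Or.inl hf)) (fun t => (q t).1) (fun t => ((q (τ t)).2, k t))
      (fun i j h => hk (Prod.ext_iff.mp h).2))
    (fun σ => prod_rel I (genFlat2 m n r K)
      (fun f hf => Ideal.subset_span (Or.inr hf)) (fun t => (q t).2) (fun t => ((q (σ t)).1, k t))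
      (fun i j h => hk (Prod.ext_iff.mp h).2))
  rw [← Ideal.Quotient.eq_zero_iff_mem, ← this, ← Matrix.det_transpose, Matrix.det_apply, map_sum]
  refine Finset.sum_congr rfl fun σ _ => ?_
  rw [Units.smul_def, map_zsmul]
  rfl

/-- The point used for the converse. -/
noncomputable def pt {K : Type*} [Field K] {m n r w : ℕ} (k : Fin w → Fin r)
    (q : Fin w → Fin m × Fin n) : Fin m × Fin n × Fin r → K :=
  open Classical in fun x => if ∃ t, q t = (x.1, x.2.1) ∧ k t = x.2.2 then 1 else 0

lemma det_zero_of_small {R : Type*} [CommRing R] {u : ℕ} (hu : 0 < u)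
    (A : Matrix (Fin u) (Fin u) R)
    (p : Fin u → ℕ) (hp : Function.Injective p) (h : ∀ i j, u - 1 ≤ p i → A i j = 0) :
    A.det = 0 := by
  have : ∃ i, u - 1 ≤ p i := by
    by_contra hc
    push Not at hc
    have := Finset.card_le_card_of_injOn (s := (Finset.univ : Finset (Fin u)))
      (t := Finset.range (u - 1)) p (fun i _ => by simpa using hc i) hp.injOn
    simp at this
    omega
  obtain ⟨i, hi⟩ := this
  exact Matrix.det_eq_zero_of_row_eq_zero i (fun j => h i j hi)

lemma exists_minor3 {K : Type*} [Field K] {m n r u v w : ℕ} (hu : 0 < u) (hv : 0 < v)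
    (hum : u ≤ m) (hvn : v ≤ n) (hwr : w ≤ r)
    (hw : w ≤ (u - 1) * (v - 1)) :
    ∃ f ∈ minorsOf (genFlat3 m n r K) w,
    f ∉ Ideal.span (minorsOf (genFlat1 m n r K) u ∪ minorsOf (genFlat2 m n r K) v) := by
  classical
  let k : Fin w → Fin r := Fin.castLE hwr
  let q0 : Fin w → Fin (u - 1) × Fin (v - 1) := fun t => finProdFinEquiv.symm (Fin.castLE hw t)
  let q : Fin w → Fin m × Fin n := fun t =>
    (Fin.castLE (by omega) (q0 t).1, Fin.castLE (by omega) (q0 t).2)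
  have hk : Function.Injective k := Fin.castLE_injective hwr
  have hq0 : Function.Injective q0 := finProdFinEquiv.symm.injective.comp (Fin.castLE_injective hw)
  have hq : Function.Injective q := by
    intro a b h
    apply hq0
    simp only [q, Prod.mk.injEq, Fin.castLE_inj] at h
    exact Prod.ext h.1 h.2
  refine ⟨_, ⟨k, q, hk, hq, rfl⟩, fun hmem => ?_⟩
  let ev : MvPolynomial (Fin m × Fin n × Fin r) K →+* K := eval (pt k q)
  have hker : Ideal.span (minorsOf (genFlat1 m n r K) u ∪ minorsOf (genFlat2 m n r K) v) ≤
      RingHom.ker ev := by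
    rw [Ideal.span_le]
    rintro f (⟨p, s, hp, hs, rfl⟩ | ⟨p, s, hp, hs, rfl⟩)
    · change ev _ = 0
      rw [RingHom.map_det]
      apply det_zero_of_small hu _ (fun i => (p i : ℕ))
        (fun i j h => hp (Fin.ext h))
      intro i j hij
      simp only [RingHom.mapMatrix_apply, Matrix.map_apply, Matrix.submatrix_apply, genFlat1,
        Matrix.of_apply, ev, eval_X, pt]
      rw [if_neg]
      rintro ⟨t, ht, -⟩
      have := congrArg (fun x => (x.1 : ℕ)) ht
      simp only [q, Fin.val_castLE] at this
      have := (q0 t).1.2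
      omega
    · change ev _ = 0
      rw [RingHom.map_det]
      apply det_zero_of_small hv _ (fun i => (p i : ℕ))
        (fun i j h => hp (Fin.ext h))
      intro i j hij
      simp only [RingHom.mapMatrix_apply, Matrix.map_apply, Matrix.submatrix_apply, genFlat2,
        Matrix.of_apply, ev, eval_X, pt]
      rw [if_neg]
      rintro ⟨t, ht, -⟩
      have := congrArg (fun x => (x.2 : ℕ)) ht
      simp only [q, Fin.val_castLE] at this
      have := (q0 t).2.2
      omega
  have h0 : ev _ = 0 := hker hmem
  rw [RingHom.map_det] at h0
  have h1 : ev.mapMatrix ((genFlat3 m n r K).submatrix k q) = 1 := by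
    ext i j
    simp only [RingHom.mapMatrix_apply, Matrix.map_apply, Matrix.submatrix_apply, genFlat3,
        Matrix.of_apply, ev, eval_X, pt, Prod.mk.eta, Matrix.one_apply]
    congr 1
    apply propext
    constructor
    · rintro ⟨t, h1, h2⟩
      rw [← hq h1, ← hk h2]
    · rintro rfl
      exact ⟨i, rfl, rfl⟩
  rw [h1, Matrix.det_one] at h0
  exact one_ne_zero h0

end TripleDet

/-- Over an algebraically closed field, the double determinantal ideal `I_{u,v}` equals the
triple determinantal ideal `I_{u,v,w}` if and only if `(u−1)(v−1) ≤ w−1`. -/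
theorem stmt_13 {K : Type*} [Field K] [IsAlgClosed K] (m n r u v w : ℕ)
    (hu : 2 ≤ u) (hv : 2 ≤ v) (hw : 2 ≤ w)
    (hum : u ≤ m) (hunr : u ≤ n * r) (hvn : v ≤ n) (hvmr : v ≤ m * r)
    (hwr : w ≤ r) (hwmn : w ≤ m * n) :
    Ideal.span (minorsOf (genFlat1 m n r K) u ∪ minorsOf (genFlat2 m n r K) v) =
      Ideal.span (minorsOf (genFlat1 m n r K) u ∪ minorsOf (genFlat2 m n r K) v) ⊔
        Ideal.span (minorsOf (genFlat3 m n r K) w) ↔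
      (u - 1) * (v - 1) ≤ w - 1 := by
  have hmul := Nat.mul_pos (show 0 < u - 1 by omega) (show 0 < v - 1 by omega)
  constructor
  · intro heq
    by_contra hlt
    obtain ⟨f, hf, hnot⟩ := TripleDet.exists_minor3 (K := K) (m := m) (n := n) (r := r)
      (u := u) (v := v) (w := w) (by omega) (by omega) hum hvn hwr (by omega)
    apply hnot
    rw [heq]
    exact Ideal.mem_sup_right (Ideal.subset_span hf)
  · intro hle
    refine (sup_eq_left.mpr ?_).symm
    rw [Ideal.span_le]
    intro f hf
    exact TripleDet.minor3_mem (by omega) (by omega) (by omega) f hf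
end
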